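/- arXiv:2208.11733 — 8 statements merged into one kernel-verified Lean document; each statement's English description precedes it below -/
import Mathlib

section
/- Let q ≥ 1 be an integer and let X be a connected (q+1)-regular simple graph with fixed base vertex x0. Then for every vertex x of X and every integer t ≥ 0, the discrete time heat kernel satisfies K_X(x0,x;t) = (−q)^t · Σ_{m=0}^{t} b_m(x) · q^{−m/2} · I_m^{−2/√q}(t). -/
open Finset

/-- The discrete `I`-Bessel function `I_n^c(t)` (real parameter `c`). -/
noncomputable def besselI (c : ℝ) (n t : ℕ) : ℝ :=
  if n ≤ t then
    ∑ j ∈ Finset.range ((t - n) / 2 + 1),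
      (t.factorial : ℝ) /
          ((j.factorial : ℝ) * ((t - 2 * j - n).factorial : ℝ) * ((n + j).factorial : ℝ)) *
        (c / 2) ^ (2 * j + n)
  else 0

/-- A walk is non-backtracking if no step is immediately followed by the reverse step. -/
def Nonbacktracking {V : Type*} {G : SimpleGraph V} {u v : V} (p : G.Walk u v) : Prop :=
  List.Chain' (fun d₁ d₂ => d₂ ≠ d₁.symm) p.darts

/-- `cCount G x0 x m` is the number of non-backtracking walks of length `m` from `x0` to `x`. -/
noncomputable def cCount {V : Type*} (G : SimpleGraph V) (x0 x : V) (m : ℕ) : ℕ :=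
  Nat.card {p : G.Walk x0 x // p.length = m ∧ Nonbacktracking p}

/-- The coefficients `b_m(x)`:  `b_m(x) = c_m(x) - (q-1)(c_{m-2}(x) + c_{m-4}(x) + ⋯ + c_*(x))`,
where the sum goes down to `c_0(x)` for even `m` and `c_1(x)` for odd `m`. -/
noncomputable def bCoef {V : Type*} (q : ℕ) (G : SimpleGraph V) (x0 x : V) (m : ℕ) : ℝ :=
  (cCount G x0 x m : ℝ) -
    ((q : ℝ) - 1) * ∑ k ∈ Finset.Icc 1 (m / 2), (cCount G x0 x (m - 2 * k) : ℝ)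

/-- The `j`-th summand of the discrete Bessel function, written with binomial coefficients
so that it vanishes outside the summation range. -/
def besselTerm (a : ℝ) (n t j : ℕ) : ℝ :=
  (t.choose (2 * j + n) : ℝ) * ((2 * j + n).choose j : ℝ) * a ^ (2 * j + n)

theorem besselTerm_succ_zero (a : ℝ) (n t : ℕ) :
    besselTerm a (n + 1) (t + 1) 0 = besselTerm a (n + 1) t 0 + a * besselTerm a n t 0 := by
  simp only [besselTerm, mul_zero, zero_add, Nat.choose_zero_right, Nat.choose_succ_succ]
  push_cast
  ring

theorem besselTerm_succ_succ (a : ℝ) (n t j : ℕ) :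
    besselTerm a (n + 1) (t + 1) (j + 1) = besselTerm a (n + 1) t (j + 1) +
      a * (besselTerm a (n + 2) t j + besselTerm a n t (j + 1)) := by
  have h₁ : 2 * (j + 1) + (n + 1) = (2 * j + n + 2) + 1 := by ring
  have h₂ : 2 * (j + 1) + n = 2 * j + n + 2 := by ring
  have h₃ : 2 * j + (n + 2) = 2 * j + n + 2 := by ring
  simp only [besselTerm, h₁, h₂, h₃]
  rw [Nat.choose_succ_succ t, Nat.choose_succ_succ (2 * j + n + 2) j]
  push_cast
  ring

theorem besselTerm_zero_succ_succ (a : ℝ) (t j : ℕ) :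
    besselTerm a 0 (t + 1) (j + 1) = besselTerm a 0 t (j + 1) + 2 * a * besselTerm a 1 t j := by
  have h₁ : 2 * (j + 1) + 0 = (2 * j + 1) + 1 := by ring
  have h₂ : (2 * j + 1).choose (j + 1) = (2 * j + 1).choose j :=
    Nat.choose_symm_half j
  simp only [besselTerm, h₁]
  rw [Nat.choose_succ_succ t, Nat.choose_succ_succ (2 * j + 1) j, h₂]
  push_cast
  ring

theorem besselI_eq_sum_besselTerm (c : ℝ) (n t N : ℕ) (hN : t + 1 ≤ N) :
    besselI c n t = ∑ j ∈ range N, besselTerm (c / 2) n t j := by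
  have hvan : ∀ j, t < 2 * j + n → besselTerm (c / 2) n t j = 0 := fun j hj => by
    simp [besselTerm, Nat.choose_eq_zero_of_lt hj]
  unfold besselI
  split_ifs with h
  · rw [← sum_subset (range_mono (by omega : (t - n) / 2 + 1 ≤ N))
      (fun j _ hj => hvan j (by rw [mem_range] at hj; omega))]
    refine sum_congr rfl fun j hj => ?_
    rw [mem_range] at hj
    have e₁ := Nat.choose_mul_factorial_mul_factorial (by omega : 2 * j + n ≤ t)
    have e₂ := Nat.choose_mul_factorial_mul_factorial (by omega : j ≤ 2 * j + n)
    rw [show 2 * j + n - j = n + j by omega] at e₂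
    rw [← e₁, ← e₂, Nat.sub_sub]
    unfold besselTerm
    push_cast
    field_simp
  · exact (sum_eq_zero fun j _ => hvan j (by omega)).symm

theorem besselI_of_lt (c : ℝ) {n t : ℕ} (h : t < n) : besselI c n t = 0 :=
  if_neg (by omega)

theorem besselI_zero_zero (c : ℝ) : besselI c 0 0 = 1 := by
  simp [besselI]

theorem besselI_zero_succ (c : ℝ) (t : ℕ) :
    besselI c 0 (t + 1) = besselI c 0 t + 2 * (c / 2) * besselI c 1 t := by
  rw [besselI_eq_sum_besselTerm c 0 (t + 1) (t + 2) le_rfl,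
    besselI_eq_sum_besselTerm c 0 t (t + 2) (by omega),
    besselI_eq_sum_besselTerm c 1 t (t + 1) le_rfl]
  simp only [sum_range_succ' _ (t + 1), besselTerm_zero_succ_succ, sum_add_distrib, ← mul_sum]
  have h : besselTerm (c / 2) 0 (t + 1) 0 = besselTerm (c / 2) 0 t 0 := by simp [besselTerm]
  rw [h]
  ring

theorem besselI_succ_succ (c : ℝ) (n t : ℕ) :
    besselI c (n + 1) (t + 1) =
      besselI c (n + 1) t + c / 2 * (besselI c n t + besselI c (n + 2) t) := by
  rw [besselI_eq_sum_besselTerm c (n + 1) (t + 1) (t + 2) le_rfl,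
    besselI_eq_sum_besselTerm c (n + 1) t (t + 2) (by omega),
    besselI_eq_sum_besselTerm c n t (t + 2) (by omega),
    besselI_eq_sum_besselTerm c (n + 2) t (t + 1) le_rfl]
  simp only [sum_range_succ' _ (t + 1), besselTerm_succ_succ, besselTerm_succ_zero,
    sum_add_distrib, ← mul_sum]
  ring

section Walks

variable {V : Type*} {G : SimpleGraph V}

theorem nonbacktracking_reverse {u v : V} (p : G.Walk u v) :
    Nonbacktracking p.reverse ↔ Nonbacktracking p := by
  change List.IsChain _ _ ↔ List.IsChain _ _
  rw [SimpleGraph.Walk.darts_reverse, List.isChain_reverse, List.isChain_map]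
  simp only [SimpleGraph.Dart.symm_symm, ne_eq, @eq_comm _ (SimpleGraph.Dart.symm _)]

theorem nonbacktracking_cons_nil {u v : V} (h : G.Adj u v) :
    Nonbacktracking (SimpleGraph.Walk.cons h .nil) := by
  change List.IsChain _ _
  simp

theorem nonbacktracking_cons_cons {u v w z : V} (h : G.Adj u v) (h' : G.Adj v w)
    (p : G.Walk w z) :
    Nonbacktracking (.cons h (.cons h' p)) ↔ w ≠ u ∧ Nonbacktracking (.cons h' p) := by
  change List.IsChain _ _ ↔ _ ∧ List.IsChain _ _
  simp only [SimpleGraph.Walk.darts_cons, List.isChain_cons_cons]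
  refine and_congr_left' (not_congr ?_)
  simp [SimpleGraph.Dart.ext_iff]

theorem cCount_eq_card_reverse (x0 x : V) (m : ℕ) :
    cCount G x0 x m = Nat.card {p : G.Walk x x0 // p.length = m ∧ Nonbacktracking p} :=
  Nat.card_congr
    { toFun := fun p => ⟨p.1.reverse, by
        rw [SimpleGraph.Walk.length_reverse, nonbacktracking_reverse]; exact p.2⟩
      invFun := fun p => ⟨p.1.reverse, by
        rw [SimpleGraph.Walk.length_reverse, nonbacktracking_reverse]; exact p.2⟩
      left_inv := fun p => Subtype.ext p.1.reverse_reverse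
      right_inv := fun p => Subtype.ext p.1.reverse_reverse }

/-- Number of walks `p` of length `m` from `w` to `v` for which prefixing the step `u → w`
gives a non-backtracking walk. -/
noncomputable def stepCount (G : SimpleGraph V) (v : V) (m : ℕ) (u w : V) : ℕ :=
  Nat.card {p : G.Walk w v // p.length = m ∧ ∀ h : G.Adj u w, Nonbacktracking (.cons h p)}

theorem stepCount_zero (v u w : V) :
    stepCount G v 0 u w = cCount G v w 0 := by
  rw [cCount_eq_card_reverse]
  refine Nat.card_congr (Equiv.subtypeEquivRight fun p => and_congr_right fun hp => ?_)
  cases p with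
  | nil => exact iff_of_true nonbacktracking_cons_nil List.isChain_nil
  | cons h p => simp at hp

theorem cCount_zero [DecidableEq V] (x0 x : V) : cCount G x0 x 0 = if x = x0 then 1 else 0 := by
  rw [cCount_eq_card_reverse]
  split_ifs with h
  · subst h
    rw [Nat.card_eq_one_iff_unique]
    refine ⟨⟨?_⟩, ⟨.nil, rfl, List.isChain_nil⟩⟩
    rintro ⟨p, hp, _⟩ ⟨p', hp', _⟩
    cases p with
    | nil =>
      cases p' with
      | nil => rfl
      | cons h p' => simp at hp'
    | cons h p => simp at hp
  · rw [Nat.card_eq_zero]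
    exact .inl ⟨fun p => h (SimpleGraph.Walk.eq_of_length_eq_zero p.2.1)⟩

variable [DecidableEq V] [G.LocallyFinite]

theorem card_walk_succ (u v : V) (n : ℕ) (P : G.Walk u v → Prop) :
    Nat.card {p : G.Walk u v // p.length = n + 1 ∧ P p} =
      ∑ w ∈ G.neighborFinset u,
        Nat.card {p : G.Walk w v // p.length = n ∧ ∀ h : G.Adj u w, P (.cons h p)} := by
  have hfin : ∀ w, Finite {p : G.Walk w v // p.length = n ∧ ∀ h : G.Adj u w, P (.cons h p)} :=
    fun w => Finite.of_injective
      (fun p => (⟨p.1, p.2.1⟩ : {p : G.Walk w v // p.length = n}))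
      fun p p' h => Subtype.ext (congrArg (fun r => r.1) h)
  have e : (Σ w : {w // w ∈ G.neighborFinset u},
      {p : G.Walk w.1 v // p.length = n ∧ ∀ h : G.Adj u w, P (.cons h p)}) ≃
      {p : G.Walk u v // p.length = n + 1 ∧ P p} :=
    Equiv.ofBijective
      (fun r => ⟨.cons ((G.mem_neighborFinset u r.1.1).1 r.1.2) r.2.1,
        by simp [r.2.2.1], r.2.2.2 _⟩) <| by
      constructor
      · rintro ⟨⟨w, hw⟩, p, hp⟩ ⟨⟨w', hw'⟩, p', hp'⟩ h
        simp only [Subtype.mk.injEq, SimpleGraph.Walk.cons.injEq] at h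
        obtain ⟨rfl, h⟩ := h
        obtain rfl := eq_of_heq h
        rfl
      · rintro ⟨p, hl, hp⟩
        cases p with
        | nil => simp at hl
        | cons h p =>
          exact ⟨⟨⟨_, (G.mem_neighborFinset u _).2 h⟩, p, by simpa using hl, fun _ => hp⟩, rfl⟩
  rw [← Nat.card_congr e, Nat.card_sigma]
  exact sum_coe_sort (G.neighborFinset u) fun w =>
    Nat.card {p : G.Walk w v // p.length = n ∧ ∀ h : G.Adj u w, P (.cons h p)}

theorem cCount_succ (x0 x : V) (m : ℕ) :
    cCount G x0 x (m + 1) = ∑ y ∈ G.neighborFinset x, stepCount G x0 m x y := by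
  rw [cCount_eq_card_reverse, card_walk_succ]
  rfl

theorem stepCount_succ (v : V) (m : ℕ) {u w : V} (huw : G.Adj u w) :
    stepCount G v (m + 1) u w =
      ∑ z ∈ G.neighborFinset w, if z = u then 0 else stepCount G v m w z := by
  rw [stepCount, card_walk_succ]
  refine sum_congr rfl fun z _ => ?_
  simp only [nonbacktracking_cons_cons, huw, forall_true_left]
  split_ifs with h
  · subst h
    simp [huw.symm]
  · simp [h, stepCount]

theorem sum_cCount_zero (x0 x : V) :
    ∑ y ∈ G.neighborFinset x, cCount G x0 y 0 = cCount G x0 x 1 := by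
  simp only [cCount_succ, stepCount_zero]

theorem sum_cCount_succ (x0 x : V) (m : ℕ) :
    ∑ y ∈ G.neighborFinset x, cCount G x0 y (m + 1) =
      cCount G x0 x (m + 2) + ∑ y ∈ G.neighborFinset x, stepCount G x0 m y x := by
  rw [cCount_succ x0 x (m + 1), ← sum_add_distrib]
  refine sum_congr rfl fun y hy => ?_
  have hxy : G.Adj x y := (G.mem_neighborFinset x y).1 hy
  rw [stepCount_succ _ _ hxy, cCount_succ, ← sum_erase_add _ _
    ((G.mem_neighborFinset y x).2 hxy.symm)]
  congr 1
  rw [← sum_erase_add _ _ ((G.mem_neighborFinset y x).2 hxy.symm)]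
  simp only [if_true, add_zero]
  exact sum_congr rfl fun z hz => (if_neg (ne_of_mem_erase hz)).symm

theorem sum_cCount_one {q : ℕ} (hreg : G.IsRegularOfDegree (q + 1)) (x0 x : V) :
    ∑ y ∈ G.neighborFinset x, cCount G x0 y 1 =
      cCount G x0 x 2 + (q + 1) * cCount G x0 x 0 := by
  rw [sum_cCount_succ]
  simp [stepCount_zero, hreg.degree_eq x]

theorem sum_cCount_add_two {q : ℕ} (hreg : G.IsRegularOfDegree (q + 1)) (x0 x : V) (m : ℕ) :
    ∑ y ∈ G.neighborFinset x, cCount G x0 y (m + 2) =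
      cCount G x0 x (m + 3) + q * cCount G x0 x (m + 1) := by
  rw [sum_cCount_succ, cCount_succ x0 x m]
  congr 1
  have h : ∀ y ∈ G.neighborFinset x, stepCount G x0 (m + 1) y x =
      ∑ z ∈ G.neighborFinset x, if z = y then 0 else stepCount G x0 m x z := fun y hy =>
    stepCount_succ _ _ ((G.mem_neighborFinset x y).1 hy).symm
  rw [sum_congr rfl h, sum_comm, mul_sum]
  refine sum_congr rfl fun z hz => ?_
  rw [← sum_erase_add _ _ hz, if_pos rfl, add_zero,
    sum_congr rfl fun y hy => if_neg (ne_of_mem_erase hy).symm, sum_const, card_erase_of_mem hz,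
    G.card_neighborFinset_eq_degree, hreg.degree_eq x, smul_eq_mul, Nat.add_sub_cancel]

end Walks

section Coefficients

variable {V : Type*} {G : SimpleGraph V}

/-- The sum `c_{m-2}(x) + c_{m-4}(x) + ⋯` entering the definition of `bCoef`. -/
noncomputable def cTail (G : SimpleGraph V) (x0 x : V) (m : ℕ) : ℝ :=
  ∑ k ∈ Icc 1 (m / 2), (cCount G x0 x (m - 2 * k) : ℝ)

theorem cTail_add_two (x0 x : V) (m : ℕ) :
    cTail G x0 x (m + 2) = cCount G x0 x m + cTail G x0 x m := by
  simp only [cTail, ← Ico_add_one_right_eq_Icc, sum_Ico_eq_sum_range]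
  rw [show (m + 2) / 2 + 1 - 1 = m / 2 + 1 by omega, sum_range_succ', add_comm]
  congr 1
  exact sum_congr rfl fun k _ => by congr 2; omega

theorem cTail_zero (x0 x : V) : cTail G x0 x 0 = 0 := by simp [cTail]

theorem cTail_one (x0 x : V) : cTail G x0 x 1 = 0 := by simp [cTail]

theorem bCoef_eq (q : ℕ) (x0 x : V) (m : ℕ) :
    bCoef q G x0 x m = cCount G x0 x m - ((q : ℝ) - 1) * cTail G x0 x m := rfl

variable [DecidableEq V] [G.LocallyFinite]

theorem sum_cTail_add_two {q : ℕ} (hreg : G.IsRegularOfDegree (q + 1)) (x0 x : V) (m : ℕ) :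
    ∑ y ∈ G.neighborFinset x, cTail G x0 y (m + 2) =
      cTail G x0 x (m + 3) + q * cTail G x0 x (m + 1) := by
  induction m using Nat.twoStepInduction with
  | zero =>
    have h : (∑ y ∈ G.neighborFinset x, (cCount G x0 y 0 : ℝ)) = cCount G x0 x 1 := by
      exact_mod_cast sum_cCount_zero x0 x
    simp only [cTail_add_two, cTail_zero, cTail_one, zero_add, add_zero, mul_zero, h]
  | one =>
    have h : (∑ y ∈ G.neighborFinset x, (cCount G x0 y 1 : ℝ)) =
        cCount G x0 x 2 + (q + 1) * cCount G x0 x 0 := by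
      exact_mod_cast sum_cCount_one hreg x0 x
    simp only [Nat.reduceAdd, cTail_add_two _ _ 1, cTail_add_two _ _ 2, cTail_add_two _ _ 0,
      cTail_zero, cTail_one, add_zero, h]
    ring
  | more m ih _ =>
    have h : (∑ y ∈ G.neighborFinset x, (cCount G x0 y (m + 2) : ℝ)) =
        cCount G x0 x (m + 3) + q * cCount G x0 x (m + 1) := by
      exact_mod_cast sum_cCount_add_two hreg x0 x m
    simp only [cTail_add_two _ _ (m + 2), cTail_add_two _ _ (m + 2 + 1), sum_add_distrib, h, ih,
      show m + 2 + 3 = m + 3 + 2 from rfl,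
      show m + 2 + 1 = m + 1 + 2 from rfl]
    rw [cTail_add_two _ _ (m + 1)]
    ring

theorem sum_bCoef_zero (q : ℕ) (x0 x : V) :
    ∑ y ∈ G.neighborFinset x, bCoef q G x0 y 0 = bCoef q G x0 x 1 := by
  simp only [bCoef_eq, cTail_zero, cTail_one, mul_zero, sub_zero]
  exact_mod_cast sum_cCount_zero x0 x

theorem sum_bCoef_one {q : ℕ} (hreg : G.IsRegularOfDegree (q + 1)) (x0 x : V) :
    ∑ y ∈ G.neighborFinset x, bCoef q G x0 y 1 =
      bCoef q G x0 x 2 + 2 * q * bCoef q G x0 x 0 := by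
  have h : (∑ y ∈ G.neighborFinset x, (cCount G x0 y 1 : ℝ)) =
      cCount G x0 x 2 + (q + 1) * cCount G x0 x 0 := by
    exact_mod_cast sum_cCount_one hreg x0 x
  simp only [bCoef_eq, cTail_add_two _ _ 0, cTail_zero, cTail_one, mul_zero, sub_zero, h, add_zero]
  ring

theorem sum_bCoef_add_two {q : ℕ} (hreg : G.IsRegularOfDegree (q + 1)) (x0 x : V) (m : ℕ) :
    ∑ y ∈ G.neighborFinset x, bCoef q G x0 y (m + 2) =
      bCoef q G x0 x (m + 3) + q * bCoef q G x0 x (m + 1) := by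
  have h : (∑ y ∈ G.neighborFinset x, (cCount G x0 y (m + 2) : ℝ)) =
      cCount G x0 x (m + 3) + q * cCount G x0 x (m + 1) := by
    exact_mod_cast sum_cCount_add_two hreg x0 x m
  simp only [bCoef_eq, sum_sub_distrib, ← mul_sum, h, sum_cTail_add_two hreg]
  ring

end Coefficients

/-- Summation by parts for a sequence `α` obtained from `β` by a three-term recurrence. -/
theorem sum_mul_of_three_term {α β f : ℕ → ℝ} {s : ℝ} (h0 : α 0 = s * β 1)
    (h1 : α 1 = s * (β 2 + 2 * β 0)) (h2 : ∀ m, α (m + 2) = s * (β (m + 3) + β (m + 1))) (T : ℕ) :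
    ∑ m ∈ range (T + 2), α m * f m =
      s * (2 * β 0 * f 1 + ∑ m ∈ range (T + 2), β (m + 1) * (f m + f (m + 2))) -
        s * (β (T + 1) * f (T + 2) + β (T + 2) * f (T + 3)) := by
  induction T with
  | zero =>
    simp only [zero_add, sum_range_succ, sum_range_zero, h0, h1]
    ring
  | succ T ih =>
    rw [sum_range_succ, ih, h2, sum_range_succ _ (T + 2)]
    ring

theorem stmt0 {V : Type*} [DecidableEq V] (q : ℕ) (hq : 1 ≤ q) (G : SimpleGraph V)
    [G.LocallyFinite] (hconn : G.Connected) (hreg : G.IsRegularOfDegree (q + 1)) (x0 : V)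
    (K : V → ℕ → ℝ)
    (hK0 : ∀ x, K x 0 = if x = x0 then 1 else 0)
    (hKrec : ∀ x t, K x (t + 1) = (∑ y ∈ G.neighborFinset x, K y t) - (q : ℝ) * K x t)
    (x : V) (t : ℕ) :
    K x t = (-(q : ℝ)) ^ t * ∑ m ∈ Finset.range (t + 1),
      bCoef q G x0 x m * ((Real.sqrt q) ^ m)⁻¹ * besselI (-2 / Real.sqrt q) m t := by
  have hq0 : (0 : ℝ) < q := by exact_mod_cast hq
  set s := Real.sqrt q with hs
  have hs0 : s ≠ 0 := (Real.sqrt_pos.2 hq0).ne'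
  have hss : (q : ℝ) = s * s := (Real.mul_self_sqrt hq0.le).symm
  induction t generalizing x with
  | zero => simp [hK0, besselI_zero_zero, bCoef_eq, cTail_zero, cCount_zero]
  | succ t ih =>
    set c := -2 / s with hc
    have hca : c / 2 = -s⁻¹ := by rw [hc]; ring
    have ext_sum : ∀ y, ∑ m ∈ range (t + 1), bCoef q G x0 y m * (s ^ m)⁻¹ * besselI c m t =
        ∑ m ∈ range (t + 2), bCoef q G x0 y m * (s ^ m)⁻¹ * besselI c m t := fun y => by
      rw [sum_range_succ _ (t + 1), besselI_of_lt c (Nat.lt_succ_self t), mul_zero, add_zero]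
    have hA : ∑ y ∈ G.neighborFinset x,
        ∑ m ∈ range (t + 2), bCoef q G x0 y m * (s ^ m)⁻¹ * besselI c m t =
        s * (2 * (bCoef q G x0 x 0 * (s ^ 0)⁻¹) * besselI c 1 t + ∑ m ∈ range (t + 2),
          bCoef q G x0 x (m + 1) * (s ^ (m + 1))⁻¹ * (besselI c m t + besselI c (m + 2) t)) := by
      rw [sum_comm]
      simp only [← sum_mul]
      rw [sum_mul_of_three_term (s := s) (f := fun m => besselI c m t)
        (β := fun m => bCoef q G x0 x m * (s ^ m)⁻¹)]
      · rw [besselI_of_lt c (by omega : t < t + 2), besselI_of_lt c (by omega : t < t + 3)]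
        ring
      · rw [sum_bCoef_zero]
        field_simp
      · rw [sum_bCoef_one hreg, hss]
        field_simp
      · intro m
        rw [sum_bCoef_add_two hreg, hss]
        field_simp
        ring
    have hS : ∑ m ∈ range (t + 1 + 1), bCoef q G x0 x m * (s ^ m)⁻¹ * besselI c m (t + 1) =
        ∑ m ∈ range (t + 2), bCoef q G x0 x m * (s ^ m)⁻¹ * besselI c m t -
        s⁻¹ * (2 * (bCoef q G x0 x 0 * (s ^ 0)⁻¹) * besselI c 1 t + ∑ m ∈ range (t + 2),
          bCoef q G x0 x (m + 1) * (s ^ (m + 1))⁻¹ * (besselI c m t + besselI c (m + 2) t)) := by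
      have hshift : ∑ m ∈ range (t + 1),
          bCoef q G x0 x (m + 1) * (s ^ (m + 1))⁻¹ * besselI c (m + 1) (t + 1) =
          ∑ m ∈ range (t + 1), bCoef q G x0 x (m + 1) * (s ^ (m + 1))⁻¹ * besselI c (m + 1) t -
          s⁻¹ * ∑ m ∈ range (t + 1),
            bCoef q G x0 x (m + 1) * (s ^ (m + 1))⁻¹ * (besselI c m t + besselI c (m + 2) t) := by
        rw [mul_sum, ← sum_sub_distrib]
        refine sum_congr rfl fun m _ => ?_
        rw [besselI_succ_succ, hca]
        ring
      rw [sum_range_succ', hshift, sum_range_succ' (fun m => _ * besselI c m t) (t + 1),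
        sum_range_succ (fun m => _ * (besselI c m t + _)) (t + 1), besselI_zero_succ, hca,
        besselI_of_lt c (by omega : t < t + 1), besselI_of_lt c (by omega : t < t + 1 + 2)]
      ring
    rw [hKrec, ih, sum_congr rfl fun y _ => ih y, ← mul_sum, ext_sum x,
      sum_congr rfl fun y _ => ext_sum y, hA, hS, pow_succ, hss]
    field_simp
    ring
end

section
/- Let q ≥ 1 be an integer and let X be a finite connected (q+1)-regular simple graph with M vertices and adjacency matrix A. Then for every integer t ≥ 0, (−q)^{−t} · trace((A − q·Id)^t) = Σ_{m=0}^{t} N_m · q^{−m/2} · I_m^{−2/√q}(t) + M·(1−q) · Σ_{j=1}^{⌊t/2⌋} q^{−j} · I_{2j}^{−2/√q}(t). (Equivalently, the left-hand side equals Σ_{j=0}^{M−1} (1 − λ_j/q)^t, where λ_0, …, λ_{M−1} are the eigenvalues of A counted with multiplicity.) -/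
open Finset

/-- A closed walk is tailless if its last step is not the reverse of its first step. -/
def Tailless {V : Type*} {G : SimpleGraph V} {x : V} (p : G.Walk x x) : Prop :=
  ∀ d₁ ∈ p.darts.head?, ∀ d₂ ∈ p.darts.getLast?, d₂ ≠ d₁.symm

/-- `NCount G x m` is the number of closed non-backtracking tailless walks of length `m`
based at `x`. -/
noncomputable def NCount {V : Type*} (G : SimpleGraph V) (x : V) (m : ℕ) : ℕ :=
  Nat.card {p : G.Walk x x // p.length = m ∧ Nonbacktracking p ∧ Tailless p}

section NonbacktrackingCount

open Matrix

/-- The `0`-`1` matrix of a relation. -/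
def relMatrix {D : Type*} (R : D → D → Prop) [DecidableRel R] : Matrix D D ℝ :=
  Matrix.of fun d e => if R d e then 1 else 0

theorem relMatrix_apply {D : Type*} (R : D → D → Prop) [DecidableRel R] (d e : D) :
    relMatrix R d e = if R d e then 1 else 0 := rfl

theorem relMatrix_pow_apply {D : Type*} [Fintype D] [DecidableEq D] (R : D → D → Prop)
    [DecidableRel R] (k : ℕ) (d e : D) :
    (relMatrix R ^ k) d e =
      Nat.card {l : List D // l.length = k ∧ (d :: l).IsChain R ∧ (d :: l).getLast? = some e} := by
  induction k generalizing d with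
  | zero =>
    rw [pow_zero, Matrix.one_apply]
    split_ifs with h
    · subst h
      have : Unique {l : List D // l.length = 0 ∧ (d :: l).IsChain R ∧
          (d :: l).getLast? = some d} :=
        { default := ⟨[], by simp⟩
          uniq := fun ⟨l, hl⟩ => Subtype.ext (List.length_eq_zero_iff.mp hl.1) }
      rw [Nat.card_unique, Nat.cast_one]
    · have : IsEmpty {l : List D // l.length = 0 ∧ (d :: l).IsChain R ∧
          (d :: l).getLast? = some e} :=
        ⟨fun ⟨l, hl, _, h'⟩ => by
          rw [List.length_eq_zero_iff] at hl
          subst hl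
          simp [h] at h'⟩
      rw [Nat.card_of_isEmpty, Nat.cast_zero]
  | succ k ih =>
    have hfin (d' : D) : Finite {l : List D // l.length = k ∧ (d' :: l).IsChain R ∧
        (d' :: l).getLast? = some e} :=
      ((List.finite_length_eq D k).subset fun l hl => hl.1).to_subtype
    let f : (Σ d' : {d' // R d d'}, {l : List D // l.length = k ∧ (d'.1 :: l).IsChain R ∧
        (d'.1 :: l).getLast? = some e}) →
        {l : List D // l.length = k + 1 ∧ (d :: l).IsChain R ∧ (d :: l).getLast? = some e} :=
      fun x => ⟨x.1.1 :: x.2.1, by simp [x.2.2.1],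
        List.isChain_cons_cons.mpr ⟨x.1.2, x.2.2.2.1⟩, by
          rw [List.getLast?_cons_cons]; exact x.2.2.2.2⟩
    have hf : Function.Bijective f := by
      constructor
      · rintro ⟨⟨a, ha⟩, ⟨l, hl⟩⟩ ⟨⟨b, hb⟩, ⟨l', hl'⟩⟩ h
        simp only [f, Subtype.mk.injEq, List.cons.injEq] at h
        obtain ⟨rfl, rfl⟩ := h
        rfl
      · rintro ⟨l, h1, h2, h3⟩
        cases l with
        | nil => simp at h1
        | cons a l =>
          rw [List.isChain_cons_cons] at h2
          rw [List.getLast?_cons_cons] at h3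
          exact ⟨⟨⟨a, h2.1⟩, ⟨l, by simpa using h1, h2.2, h3⟩⟩, rfl⟩
    rw [← Nat.card_congr (Equiv.ofBijective f hf), Nat.card_sigma, pow_succ', Matrix.mul_apply]
    push_cast
    simp only [relMatrix_apply, ite_mul, one_mul, zero_mul]
    rw [← Finset.sum_filter]
    simp only [ih]
    exact Finset.sum_subtype _ (by simp) _

theorem trace_relMatrix_pow_succ {D : Type*} [Fintype D] [DecidableEq D] (R : D → D → Prop)
    [DecidableRel R] (m : ℕ) :
    trace (relMatrix R ^ (m + 1)) =
      Nat.card {l : List D // l.length = m + 1 ∧ l.IsChain R ∧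
        ∀ d₁ ∈ l.head?, ∀ d₂ ∈ l.getLast?, R d₂ d₁} := by
  have hfin (e : D) : Finite {l : List D // l.length = m + 1 ∧ (e :: l).IsChain R ∧
      (e :: l).getLast? = some e} :=
    ((List.finite_length_eq D (m + 1)).subset fun l hl => hl.1).to_subtype
  let f : (Σ e : D, {l : List D // l.length = m + 1 ∧ (e :: l).IsChain R ∧
      (e :: l).getLast? = some e}) → {l : List D // l.length = m + 1 ∧ l.IsChain R ∧
        ∀ d₁ ∈ l.head?, ∀ d₂ ∈ l.getLast?, R d₂ d₁} :=
    fun x => ⟨x.2.1, x.2.2.1, (List.isChain_cons.mp x.2.2.2.1).2, by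
      obtain ⟨e, l, h1, h2, h3⟩ := x
      cases l with
      | nil => simp at h1
      | cons a l =>
        rw [List.getLast?_cons_cons] at h3
        rw [List.isChain_cons] at h2
        intro d₁ hd₁ d₂ hd₂
        dsimp only at hd₁ hd₂
        rw [h3, Option.mem_some_iff] at hd₂
        exact hd₂ ▸ h2.1 d₁ hd₁⟩
  have hf : Function.Bijective f := by
    constructor
    · rintro ⟨e, ⟨l, hl⟩⟩ ⟨e', ⟨l', hl'⟩⟩ h
      simp only [f, Subtype.mk.injEq] at h
      subst h
      cases l with
      | nil => simp at hl
      | cons a l =>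
        have h1 := hl.2.2
        have h2 := hl'.2.2
        rw [List.getLast?_cons_cons] at h1 h2
        obtain rfl := Option.some_injective _ (h1.symm.trans h2)
        rfl
    · rintro ⟨l, h1, h2, h3⟩
      have hne : l ≠ [] := by rintro rfl; simp at h1
      refine ⟨⟨l.getLast hne, ⟨l, h1, List.isChain_cons.mpr
        ⟨fun d hd => h3 d hd _ (List.getLast?_eq_some_getLast hne), h2⟩, ?_⟩⟩, rfl⟩
      cases l with
      | nil => simp at h1
      | cons a l => rw [List.getLast?_cons_cons, List.getLast?_eq_some_getLast hne]
  rw [← Nat.card_congr (Equiv.ofBijective f hf), Nat.card_sigma]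
  simp [Matrix.trace, relMatrix_pow_apply]

/-- The relation on darts saying that `e` may follow `d` in a non-backtracking walk. -/
def DartFollows {V : Type*} (G : SimpleGraph V) (d e : G.Dart) : Prop :=
  G.DartAdj d e ∧ e ≠ d.symm

instance {V : Type*} [DecidableEq V] (G : SimpleGraph V) : DecidableRel (DartFollows G) :=
  fun d e => inferInstanceAs (Decidable (d.snd = e.fst ∧ e ≠ d.symm))

theorem isChain_dartFollows_iff {V : Type*} {G : SimpleGraph V} (l : List G.Dart) :
    l.IsChain (DartFollows G) ↔ l.IsChain G.DartAdj ∧ l.IsChain (fun d e => e ≠ d.symm) := by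
  induction l with
  | nil => simp
  | cons a l ih =>
    simp only [List.isChain_cons, ih, DartFollows]
    grind

theorem head_fst_eq_of_darts {V : Type*} {G : SimpleGraph V} {x y : V} (p : G.Walk x y)
    (d : G.Dart) (hd : d ∈ p.darts.head?) : d.fst = x := by
  cases p with
  | nil => simp at hd
  | cons h p => simp at hd; simp [← hd]

theorem getLast_snd_eq_of_darts {V : Type*} {G : SimpleGraph V} {x y : V} (p : G.Walk x y)
    (d : G.Dart) (hd : d ∈ p.darts.getLast?) : d.snd = y := by
  induction p with
  | nil => simp at hd
  | cons h p ih =>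
    cases p with
    | nil => simp at hd; simp [← hd]
    | cons h' p => exact ih (by simpa using hd)

theorem sum_NCount_succ {V : Type*} [Fintype V] [DecidableEq V] (G : SimpleGraph V)
    [DecidableRel G.Adj] (m : ℕ) :
    ((∑ x, NCount G x (m + 1) : ℕ) : ℝ) = trace (relMatrix (DartFollows G) ^ (m + 1)) := by
  have hfin (x : V) : Finite {p : G.Walk x x // p.length = m + 1 ∧ Nonbacktracking p ∧
      Tailless p} :=
    have : Finite {l : List G.Dart // l.length = m + 1} :=
      (List.finite_length_eq G.Dart (m + 1)).to_subtype
    Finite.of_injective (β := {l : List G.Dart // l.length = m + 1})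
      (fun p => ⟨p.1.darts, by rw [SimpleGraph.Walk.length_darts, p.2.1]⟩)
      fun p q h => Subtype.ext (SimpleGraph.Walk.darts_injective (congrArg Subtype.val h))
  let f : (Σ x : V, {p : G.Walk x x // p.length = m + 1 ∧ Nonbacktracking p ∧ Tailless p}) →
      {l : List G.Dart // l.length = m + 1 ∧ l.IsChain (DartFollows G) ∧
        ∀ d₁ ∈ l.head?, ∀ d₂ ∈ l.getLast?, DartFollows G d₂ d₁} :=
    fun x => ⟨x.2.1.darts, by rw [SimpleGraph.Walk.length_darts, x.2.2.1],
      (isChain_dartFollows_iff _).mpr ⟨x.2.1.isChain_dartAdj_darts, x.2.2.2.1⟩,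
      fun d₁ h₁ d₂ h₂ => ⟨(getLast_snd_eq_of_darts _ _ h₂).trans
        (head_fst_eq_of_darts _ _ h₁).symm, fun h => x.2.2.2.2 d₁ h₁ d₂ h₂ (by simp [h])⟩⟩
  have hf : Function.Bijective f := by
    constructor
    · rintro ⟨x, p, hp⟩ ⟨y, p', hp'⟩ h
      simp only [f, Subtype.mk.injEq] at h
      have hxy : x = y := by
        cases p with
        | nil => simp at hp
        | cons hadj p =>
          rw [← head_fst_eq_of_darts p' ⟨(_, _), hadj⟩ (by rw [← h]; simp)]
      subst hxy
      obtain rfl := SimpleGraph.Walk.darts_injective h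
      rfl
    · rintro ⟨l, h1, h2, h3⟩
      have hne : l ≠ [] := by rintro rfl; simp at h1
      rw [isChain_dartFollows_iff] at h2
      have hcl : (l.getLast hne).snd = (l.head hne).fst :=
        (h3 _ (List.head?_eq_some_head hne) _ (List.getLast?_eq_some_getLast hne)).1
      have hd : ((SimpleGraph.Walk.ofDarts l hne h2.1).copy rfl hcl).darts = l := by simp
      refine ⟨⟨_, (SimpleGraph.Walk.ofDarts l hne h2.1).copy rfl hcl, ?_, ?_, ?_⟩,
        Subtype.ext hd⟩
      · rw [← SimpleGraph.Walk.length_darts, hd, h1]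
      · rw [Nonbacktracking, hd]; exact h2.2
      · rw [Tailless, hd]
        exact fun d₁ h₁ d₂ h₂ h => (h3 d₁ h₁ d₂ h₂).2 (by simp [h])
  rw [trace_relMatrix_pow_succ, ← Nat.card_congr (Equiv.ofBijective f hf), Nat.card_sigma]
  rfl

end NonbacktrackingCount
section HashimotoTrace

open Matrix

variable {V : Type*} [DecidableEq V] (G : SimpleGraph V)

/-- The incidence matrix between vertices and the darts starting at them. -/
def dartFstMatrix : Matrix V G.Dart ℝ :=
  Matrix.of fun v d => if d.fst = v then 1 else 0

/-- The incidence matrix between vertices and the darts ending at them. -/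
def dartSndMatrix : Matrix V G.Dart ℝ :=
  Matrix.of fun v d => if d.snd = v then 1 else 0

/-- The permutation matrix of the reversal of darts. -/
def dartSymmMatrix : Matrix G.Dart G.Dart ℝ :=
  Matrix.of fun d e => if e = d.symm then 1 else 0

theorem dartSymmMatrix_transpose : (dartSymmMatrix G)ᵀ = dartSymmMatrix G := by
  ext d e
  simp only [dartSymmMatrix, transpose_apply, of_apply]
  congr 1
  rw [eq_iff_iff]
  constructor <;> rintro rfl <;> simp

theorem trace_dartSymmMatrix [Fintype V] [DecidableRel G.Adj] : trace (dartSymmMatrix G) = 0 :=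
  Finset.sum_eq_zero fun d _ => if_neg (SimpleGraph.Dart.symm_ne d).symm

theorem relMatrix_dartFollows [Fintype V] :
    relMatrix (DartFollows G) =
      (dartSndMatrix G)ᵀ * dartFstMatrix G - dartSymmMatrix G := by
  ext d e
  simp only [relMatrix, dartSndMatrix, dartFstMatrix, dartSymmMatrix, of_apply, Matrix.sub_apply,
    mul_apply, transpose_apply, DartFollows, SimpleGraph.DartAdj]
  by_cases h : e = d.symm
  · subst h; simp
  · simp [h, eq_comm]

variable [Fintype V] [DecidableRel G.Adj]

theorem dartFstMatrix_mul_transpose_dartSndMatrix :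
    dartFstMatrix G * (dartSndMatrix G)ᵀ = G.adjMatrix ℝ := by
  ext u v
  simp only [dartSndMatrix, dartFstMatrix, of_apply, mul_apply, transpose_apply,
    SimpleGraph.adjMatrix_apply, ← ite_and, mul_ite, mul_one, mul_zero]
  split_ifs with h
  · rw [Finset.sum_eq_single ⟨(u, v), h⟩] <;> simp
    intro d h1 h2 h3
    exact h1 (SimpleGraph.Dart.ext _ _ (Prod.ext h3 h2))
  · refine Finset.sum_eq_zero fun d _ => if_neg ?_
    rintro ⟨rfl, rfl⟩
    exact h d.adj

theorem dartFstMatrix_mul_dartSymmMatrix :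
    dartFstMatrix G * dartSymmMatrix G = dartSndMatrix G := by
  ext v e
  simp only [dartSndMatrix, dartFstMatrix, dartSymmMatrix, of_apply, mul_apply]
  rw [Finset.sum_eq_single e.symm]
  · simp
  · intro d _ h
    rw [if_neg (c := e = d.symm), mul_zero]
    rintro rfl; simp at h
  · simp

theorem dartSymmMatrix_mul_self : dartSymmMatrix G * dartSymmMatrix G = 1 := by
  ext d e
  simp only [dartSymmMatrix, of_apply, mul_apply, one_apply, ite_mul, one_mul, zero_mul,
    Finset.sum_ite_eq', Finset.mem_univ, if_true, SimpleGraph.Dart.symm_symm]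
  simp only [eq_comm]

theorem dartSndMatrix_mul_dartSymmMatrix :
    dartSndMatrix G * dartSymmMatrix G = dartFstMatrix G := by
  rw [← dartFstMatrix_mul_dartSymmMatrix, Matrix.mul_assoc, dartSymmMatrix_mul_self,
    Matrix.mul_one]

theorem dartSymmMatrix_mul_transpose_dartFstMatrix :
    dartSymmMatrix G * (dartFstMatrix G)ᵀ = (dartSndMatrix G)ᵀ := by
  rw [← dartFstMatrix_mul_dartSymmMatrix, transpose_mul, dartSymmMatrix_transpose]

theorem dartSymmMatrix_mul_transpose_dartSndMatrix :
    dartSymmMatrix G * (dartSndMatrix G)ᵀ = (dartFstMatrix G)ᵀ := by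
  rw [← dartSndMatrix_mul_dartSymmMatrix, transpose_mul, dartSymmMatrix_transpose]

variable {G} {q : ℕ} (hreg : G.IsRegularOfDegree (q + 1))
include hreg

theorem dartFstMatrix_mul_transpose_self :
    dartFstMatrix G * (dartFstMatrix G)ᵀ = ((q : ℝ) + 1) • 1 := by
  ext u v
  simp only [dartFstMatrix, of_apply, mul_apply, transpose_apply, Matrix.smul_apply, one_apply,
    mul_ite, mul_one, mul_zero, ← ite_and, smul_eq_mul]
  split_ifs with h
  · subst h
    have := G.dart_fst_fiber_card_eq_degree u
    rw [hreg u] at this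
    simpa using congrArg (Nat.cast (R := ℝ)) this
  · refine Finset.sum_eq_zero fun d _ => if_neg ?_
    rintro ⟨rfl, rfl⟩
    exact h rfl

theorem dartSndMatrix_mul_transpose_self :
    dartSndMatrix G * (dartSndMatrix G)ᵀ = ((q : ℝ) + 1) • 1 := by
  nth_rw 1 [← dartFstMatrix_mul_dartSymmMatrix]
  rw [Matrix.mul_assoc, dartSymmMatrix_mul_transpose_dartSndMatrix,
    dartFstMatrix_mul_transpose_self hreg]

omit hreg in
theorem dartFstMatrix_mul_relMatrix :
    dartFstMatrix G * relMatrix (DartFollows G) =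
      G.adjMatrix ℝ * dartFstMatrix G - dartSndMatrix G := by
  rw [relMatrix_dartFollows, Matrix.mul_sub, ← Matrix.mul_assoc,
    dartFstMatrix_mul_transpose_dartSndMatrix, dartFstMatrix_mul_dartSymmMatrix]

theorem dartSndMatrix_mul_relMatrix :
    dartSndMatrix G * relMatrix (DartFollows G) = (q : ℝ) • dartFstMatrix G := by
  rw [relMatrix_dartFollows, Matrix.mul_sub, ← Matrix.mul_assoc,
    dartSndMatrix_mul_transpose_self hreg, dartSndMatrix_mul_dartSymmMatrix, Matrix.smul_mul,
    Matrix.one_mul]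
  module

theorem relMatrix_mul_transpose_dartFstMatrix :
    relMatrix (DartFollows G) * (dartFstMatrix G)ᵀ = (q : ℝ) • (dartSndMatrix G)ᵀ := by
  rw [relMatrix_dartFollows, Matrix.sub_mul, Matrix.mul_assoc,
    dartFstMatrix_mul_transpose_self hreg, dartSymmMatrix_mul_transpose_dartFstMatrix,
    Matrix.mul_smul, Matrix.mul_one]
  module

omit hreg in
theorem dartSymmMatrix_mul_relMatrix :
    dartSymmMatrix G * relMatrix (DartFollows G) =
      (dartFstMatrix G)ᵀ * dartFstMatrix G - 1 := by
  rw [relMatrix_dartFollows, Matrix.mul_sub, ← Matrix.mul_assoc,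
    dartSymmMatrix_mul_transpose_dartSndMatrix, dartSymmMatrix_mul_self]

omit hreg in
variable (G) in
/-- The matrix counting non-backtracking walks of length `k + 1`. -/
noncomputable def nbWalkMatrix (k : ℕ) : Matrix V V ℝ :=
  dartFstMatrix G * relMatrix (DartFollows G) ^ k * (dartSndMatrix G)ᵀ

omit hreg in
theorem nbWalkMatrix_zero : nbWalkMatrix G 0 = G.adjMatrix ℝ := by
  rw [nbWalkMatrix, pow_zero, Matrix.mul_one, dartFstMatrix_mul_transpose_dartSndMatrix]

theorem nbWalkMatrix_one :
    nbWalkMatrix G 1 = G.adjMatrix ℝ * G.adjMatrix ℝ - ((q : ℝ) + 1) • 1 := by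
  rw [nbWalkMatrix, pow_one, dartFstMatrix_mul_relMatrix, Matrix.sub_mul, Matrix.mul_assoc,
    dartFstMatrix_mul_transpose_dartSndMatrix, dartSndMatrix_mul_transpose_self hreg]

theorem nbWalkMatrix_add_two (k : ℕ) :
    nbWalkMatrix G (k + 2) =
      G.adjMatrix ℝ * nbWalkMatrix G (k + 1) - (q : ℝ) • nbWalkMatrix G k := by
  rw [nbWalkMatrix, pow_succ', ← Matrix.mul_assoc, dartFstMatrix_mul_relMatrix,
    Matrix.sub_mul, Matrix.sub_mul, pow_succ', ← Matrix.mul_assoc (dartSndMatrix G),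
    dartSndMatrix_mul_relMatrix hreg, Matrix.smul_mul, Matrix.smul_mul, nbWalkMatrix,
    nbWalkMatrix, pow_succ']
  simp only [Matrix.mul_assoc]

omit hreg in
theorem trace_relMatrix_pow_eq (m : ℕ) :
    trace (relMatrix (DartFollows G) ^ (m + 1)) = trace (nbWalkMatrix G m) -
      trace (dartSymmMatrix G * relMatrix (DartFollows G) ^ m) := by
  rw [pow_succ']
  nth_rw 1 [relMatrix_dartFollows]
  rw [Matrix.sub_mul, trace_sub, Matrix.mul_assoc, trace_mul_comm, nbWalkMatrix]

theorem trace_relMatrix_pow_add_three (m : ℕ) :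
    trace (relMatrix (DartFollows G) ^ (m + 3)) = trace (nbWalkMatrix G (m + 2)) -
      q * trace (nbWalkMatrix G m) + trace (relMatrix (DartFollows G) ^ (m + 1)) := by
  rw [trace_relMatrix_pow_eq, pow_succ' _ (m + 1), ← Matrix.mul_assoc,
    dartSymmMatrix_mul_relMatrix, Matrix.sub_mul, trace_sub, Matrix.one_mul, Matrix.mul_assoc,
    trace_mul_comm, pow_succ, Matrix.mul_assoc, Matrix.mul_assoc,
    relMatrix_mul_transpose_dartFstMatrix hreg, Matrix.mul_smul, Matrix.mul_smul, trace_smul]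
  simp only [nbWalkMatrix, smul_eq_mul, ← Matrix.mul_assoc]
  ring

omit hreg in
theorem trace_relMatrix_dartFollows :
    trace (relMatrix (DartFollows G)) = trace (G.adjMatrix ℝ) := by
  have := trace_relMatrix_pow_eq (G := G) 0
  rw [pow_zero, Matrix.mul_one, trace_dartSymmMatrix, sub_zero, nbWalkMatrix_zero] at this
  simpa using this

omit hreg in
theorem trace_relMatrix_dartFollows_sq :
    trace (relMatrix (DartFollows G) ^ 2) = trace (nbWalkMatrix G 1) := by
  rw [trace_relMatrix_pow_eq, pow_one, dartSymmMatrix_mul_relMatrix, trace_sub,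
    sub_eq_self, sub_eq_zero]
  simp [Matrix.trace, Matrix.mul_apply, dartFstMatrix]

/-- The traces of powers of the non-backtracking matrix are given by a two-term linear
recurrence in the adjacency matrix, up to the contribution of the eigenvalues `±1`. -/
theorem trace_relMatrix_pow_succ_eq_of_recurrence (F : ℕ → Matrix V V ℝ) (hF0 : F 0 = (2 : ℝ) • 1)
    (hF1 : F 1 = G.adjMatrix ℝ)
    (hF : ∀ n, F (n + 2) = G.adjMatrix ℝ * F (n + 1) - (q : ℝ) • F n) (m : ℕ) :
    trace (relMatrix (DartFollows G) ^ (m + 1)) = trace (F (m + 1)) +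
      if Even (m + 1) then ((q : ℝ) - 1) * Fintype.card V else 0 := by
  have hF2 := hF 0
  rw [hF0, zero_add, hF1] at hF2
  have hF3 := hF 1
  rw [hF2, hF1] at hF3
  have hdiff (n : ℕ) : F (n + 3) - F (n + 1) = nbWalkMatrix G (n + 2) -
      (q : ℝ) • nbWalkMatrix G n := by
    induction n using Nat.twoStepInduction with
    | zero =>
      rw [nbWalkMatrix_add_two hreg, nbWalkMatrix_zero, zero_add, nbWalkMatrix_one hreg, hF3, hF1]
      simp only [Matrix.mul_sub, Matrix.mul_smul, Matrix.mul_one]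
      module
    | one =>
      rw [hF, nbWalkMatrix_add_two hreg, nbWalkMatrix_add_two hreg, nbWalkMatrix_zero,
        nbWalkMatrix_one hreg, hF3, hF2]
      simp only [Matrix.mul_sub, Matrix.mul_smul, Matrix.mul_one]
      module
    | more n h0 h1 =>
      have h3 : F (n + 2 + 3) = G.adjMatrix ℝ * F (n + 1 + 3) - (q : ℝ) • F (n + 3) := hF (n + 3)
      have h2 : F (n + 2 + 1) = G.adjMatrix ℝ * F (n + 1 + 1) - (q : ℝ) • F (n + 1) := hF (n + 1)
      have e : F (n + 2 + 3) - F (n + 2 + 1) = G.adjMatrix ℝ * (F (n + 1 + 3) - F (n + 1 + 1)) -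
          (q : ℝ) • (F (n + 3) - F (n + 1)) :=
        (congrArg₂ (· - ·) h3 h2).trans (by rw [Matrix.mul_sub]; module)
      rw [e, h0, h1, nbWalkMatrix_add_two hreg (n + 2), nbWalkMatrix_add_two hreg n]
      simp only [Matrix.mul_sub, Matrix.mul_smul]
      module
  induction m using Nat.twoStepInduction with
  | zero => simp [hF1, trace_relMatrix_dartFollows]
  | one =>
    rw [trace_relMatrix_dartFollows_sq, nbWalkMatrix_one hreg, hF2]
    simp [trace_sub]
    ring
  | more m ih _ =>
    have h := congrArg trace (hdiff m)
    rw [trace_sub, trace_sub, trace_smul, smul_eq_mul, sub_eq_iff_eq_add] at h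
    rw [trace_relMatrix_pow_add_three hreg, ih, h]
    have : Even (m + 2 + 1) ↔ Even (m + 1) := by grind
    simp only [this]
    ring

end HashimotoTrace

section Bessel

/-- A bilateral form of the discrete Bessel function. -/
noncomputable def besselInt (b : ℝ) (t : ℕ) (n : ℤ) : ℝ :=
  ∑ k ∈ range (t + 1), ∑ j ∈ range (k + 1),
    if n = (k : ℤ) - 2 * j then (t.choose k : ℝ) * k.choose j * b ^ k else 0

theorem besselInt_neg (b : ℝ) (t : ℕ) (n : ℤ) : besselInt b t (-n) = besselInt b t n := by
  refine Finset.sum_congr rfl fun k _ => ?_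
  rw [← Finset.sum_range_reflect]
  refine Finset.sum_congr rfl fun j hj => ?_
  have hj : j ≤ k := Nat.lt_succ_iff.mp (mem_range.mp hj)
  rw [show k + 1 - 1 - j = k - j by omega, Nat.choose_symm hj]
  refine if_congr ?_ rfl rfl
  omega

theorem besselInt_natCast (c : ℝ) (t n : ℕ) : besselInt (c / 2) t n = besselI c n t := by
  unfold besselInt besselI
  rw [Finset.sum_sigma', ← Finset.sum_filter]
  split_ifs with h
  · symm
    refine Finset.sum_bij' (fun j _ => ⟨2 * j + n, j⟩) (fun x _ => x.2) ?_ ?_ ?_ ?_ ?_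
    · intro j hj
      simp only [mem_filter, mem_sigma, mem_range] at *
      omega
    · rintro ⟨k, j⟩ hx
      simp only [mem_filter, mem_sigma, mem_range] at *
      omega
    · intros; rfl
    · rintro ⟨k, j⟩ hx
      simp only [mem_filter, mem_sigma, mem_range] at hx
      simp only [Sigma.mk.injEq, heq_eq_eq, and_true]
      omega
    · intro j hj
      simp only [mem_range] at hj
      have h1 : 2 * j + n ≤ t := by omega
      have h2 : j ≤ 2 * j + n := by omega
      rw [Nat.cast_choose ℝ h1, Nat.cast_choose ℝ h2, show 2 * j + n - j = n + j by omega,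
        show t - (2 * j + n) = t - 2 * j - n by omega]
      congr 1
      field_simp
  · refine (Finset.sum_eq_zero fun x hx => ?_)
    obtain ⟨k, j⟩ := x
    simp only [mem_filter, mem_sigma, mem_range] at hx
    omega

variable {R : Type*} [Ring R] [Algebra ℝ R]

theorem two_smul_pow_eq_sum_choose (x : R) (F : ℤ → R) (h0 : F 0 = (2 : ℝ) • 1)
    (hF : ∀ n, x * F n = F (n + 1) + F (n - 1)) (k : ℕ) :
    (2 : ℝ) • x ^ k = ∑ j ∈ range (k + 1), (k.choose j : ℝ) • F (k - 2 * j) := by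
  induction k with
  | zero => simp [h0]
  | succ k ih =>
    have h : ∑ j ∈ range (k + 1), (k.choose j : ℝ) • F (k - 2 * j + 1) =
        ∑ j ∈ range (k + 2), (k.choose j : ℝ) • F ((k + 1 : ℕ) - 2 * j) := by
      rw [Finset.sum_range_succ _ (k + 1), Nat.choose_succ_self, Nat.cast_zero, zero_smul, add_zero]
      refine Finset.sum_congr rfl fun j _ => ?_
      congr 2
      push_cast
      ring
    rw [pow_succ', ← mul_smul_comm, ih, Finset.mul_sum, Finset.sum_range_succ' _ (k + 1)]
    simp only [mul_smul_comm, hF, smul_add, Finset.sum_add_distrib, Nat.choose_succ_succ',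
      Nat.cast_add, add_smul]
    rw [h, Finset.sum_range_succ' _ (k + 1), add_comm, ← add_assoc, Nat.choose_zero_right,
      Nat.choose_zero_right]
    congr 2
    refine Finset.sum_congr rfl fun j _ => ?_
    congr 2
    push_cast
    ring

theorem two_smul_one_add_smul_pow (x : R) (F : ℤ → R) (h0 : F 0 = (2 : ℝ) • 1)
    (hF : ∀ n, x * F n = F (n + 1) + F (n - 1)) (b : ℝ) (t : ℕ) :
    (2 : ℝ) • (1 + b • x) ^ t = ∑ n ∈ Icc (-t : ℤ) t, besselInt b t n • F n := by
  simp only [besselInt, Finset.sum_smul]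
  rw [Finset.sum_comm, add_comm, (Commute.one_right _).add_pow, Finset.smul_sum]
  refine Finset.sum_congr rfl fun k hk => ?_
  have hk : k ≤ t := Nat.lt_succ_iff.mp (mem_range.mp hk)
  rw [Finset.sum_comm, one_pow, mul_one, smul_pow, ← Nat.cast_comm, ← nsmul_eq_mul,
    smul_comm _ (t.choose k), smul_comm _ (b ^ k),
    two_smul_pow_eq_sum_choose x F h0 hF, Finset.smul_sum, Finset.smul_sum]
  refine Finset.sum_congr rfl fun j hj => ?_
  have hj : j ≤ k := Nat.lt_succ_iff.mp (mem_range.mp hj)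
  rw [Finset.sum_eq_single ((k : ℤ) - 2 * j)]
  · rw [if_pos rfl, ← Nat.cast_smul_eq_nsmul ℝ, smul_smul, smul_smul]
    congr 1
    ring
  · intro n _ hn
    rw [if_neg hn, zero_smul]
  · intro h
    rw [mem_Icc] at h
    omega

theorem sum_Icc_neg_eq {M : Type*} [AddCommMonoid M] (f : ℤ → M) (hf : ∀ n, f (-n) = f n)
    (t : ℕ) :
    ∑ n ∈ Icc (-t : ℤ) t, f n = f 0 + 2 • ∑ m ∈ range t, f (m + 1) := by
  induction t with
  | zero => simp
  | succ t ih =>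
    have h : Icc (-((t + 1 : ℕ) : ℤ)) ((t + 1 : ℕ) : ℤ) =
        insert (-(t + 1 : ℤ)) (insert (t + 1 : ℤ) (Icc (-t : ℤ) t)) := by
      ext n
      simp only [mem_Icc, mem_insert]
      omega
    rw [h, Finset.sum_insert, Finset.sum_insert, ih, Finset.sum_range_succ, hf,
      smul_add, two_nsmul (f _)]
    · abel
    · simp only [mem_Icc]; omega
    · simp only [mem_Icc, mem_insert]; omega

end Bessel

theorem NCount_zero {V : Type*} (G : SimpleGraph V) (x : V) : NCount G x 0 = 1 := by
  have : Unique {p : G.Walk x x // p.length = 0 ∧ Nonbacktracking p ∧ Tailless p} :=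
    { default := ⟨.nil, rfl, List.IsChain.nil, by simp [Tailless]⟩
      uniq := fun ⟨p, hp⟩ => Subtype.ext (SimpleGraph.Walk.eq_nil_iff_nil.mpr
        (SimpleGraph.Walk.length_eq_zero_iff.mp hp.1)) }
  exact Nat.card_unique

theorem sum_range_ite_even_succ {M : Type*} [AddCommMonoid M] (f : ℕ → M) (t : ℕ) :
    (∑ m ∈ range t, if Even (m + 1) then f (m + 1) else 0) = ∑ j ∈ Icc 1 (t / 2), f (2 * j) := by
  rw [← Finset.sum_filter]
  refine Finset.sum_bij' (fun m _ => (m + 1) / 2) (fun j _ => 2 * j - 1) ?_ ?_ ?_ ?_ ?_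
  all_goals
    intro m hm
    simp only [mem_filter, mem_range, mem_Icc, Nat.even_iff] at *
  · omega
  · omega
  · omega
  · omega
  · congr 1
    omega

theorem trace_one_add_smul_pow {V : Type*} [Fintype V] [DecidableEq V] (X : Matrix V V ℝ)
    (c : ℝ) (t : ℕ) :
    Matrix.trace ((1 + (c / 2) • X) ^ t) = Fintype.card V * besselI c 0 t +
      ∑ m ∈ range t, besselI c (m + 1) t *
        Matrix.trace (Polynomial.aeval X (Polynomial.Chebyshev.C ℝ (m + 1))) := by
  have htwo : Matrix.trace (2 : Matrix V V ℝ) = 2 * Fintype.card V := by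
    rw [← one_add_one_eq_two, Matrix.trace_add, Matrix.trace_one, two_mul]
  have h := two_smul_one_add_smul_pow X
    (fun n => Polynomial.aeval X (Polynomial.Chebyshev.C ℝ n))
    (by rw [Polynomial.Chebyshev.C_zero, map_ofNat, two_smul, one_add_one_eq_two])
    (fun n => by rw [Polynomial.Chebyshev.C_add_one]; simp) (c / 2) t
  rw [sum_Icc_neg_eq _ fun n => by rw [besselInt_neg, Polynomial.Chebyshev.C_neg]] at h
  have h := congrArg Matrix.trace h
  simp only [Matrix.trace_smul, Matrix.trace_add, Matrix.trace_sum, ← Nat.cast_succ,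
    besselInt_natCast, smul_eq_mul] at h
  rw [show besselInt (c / 2) t 0 = besselI c 0 t from besselInt_natCast c t 0,
    Polynomial.Chebyshev.C_zero, map_ofNat, htwo, nsmul_eq_mul] at h
  push_cast at h ⊢
  linarith

theorem trace_chebyshev_eq {V : Type*} [Fintype V] [DecidableEq V] {q : ℕ} (hq : 1 ≤ q)
    (G : SimpleGraph V) [DecidableRel G.Adj] (hreg : G.IsRegularOfDegree (q + 1)) (m : ℕ) :
    Matrix.trace (Polynomial.aeval ((√q)⁻¹ • G.adjMatrix ℝ)
      (Polynomial.Chebyshev.C ℝ (m + 1))) =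
      (((∑ x, NCount G x (m + 1) : ℕ) : ℝ) +
        if Even (m + 1) then Fintype.card V * (1 - (q : ℝ)) else 0) * (√q ^ (m + 1))⁻¹ := by
  have hs : √(q : ℝ) ≠ 0 := by positivity
  have hsq : √(q : ℝ) ^ 2 = q := Real.sq_sqrt q.cast_nonneg
  have h := trace_relMatrix_pow_succ_eq_of_recurrence hreg
    (fun n => √(q : ℝ) ^ n • Polynomial.aeval ((√q)⁻¹ • G.adjMatrix ℝ)
      (Polynomial.Chebyshev.C ℝ n))
    (by rw [Nat.cast_zero, Polynomial.Chebyshev.C_zero, map_ofNat, two_smul, one_add_one_eq_two,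
      pow_zero, one_smul])
    (by rw [Nat.cast_one, Polynomial.Chebyshev.C_one, Polynomial.aeval_X, pow_one,
      smul_inv_smul₀ hs])
    (fun n => by
      push_cast
      rw [Polynomial.Chebyshev.C_add_two, map_sub, map_mul, Polynomial.aeval_X, smul_sub,
        Matrix.smul_mul, Matrix.mul_smul, smul_smul]
      congr 1
      · congr 1
        field_simp
        ring
      · rw [smul_smul, pow_add, hsq, mul_comm]) m
  rw [sum_NCount_succ, h, Matrix.trace_smul, smul_eq_mul, eq_mul_inv_iff_mul_eq₀ (by positivity)]
  push_cast
  split_ifs <;> ring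

theorem stmt2 {V : Type*} [Fintype V] [DecidableEq V] (q : ℕ) (hq : 1 ≤ q)
    (G : SimpleGraph V) [DecidableRel G.Adj] (hconn : G.Connected)
    (hreg : G.IsRegularOfDegree (q + 1)) (t : ℕ) :
    ((-(q : ℝ)) ^ t)⁻¹ *
        Matrix.trace ((G.adjMatrix ℝ - (q : ℝ) • (1 : Matrix V V ℝ)) ^ t) =
      (∑ m ∈ Finset.range (t + 1),
          ((∑ x : V, NCount G x m : ℕ) : ℝ) * ((Real.sqrt q) ^ m)⁻¹ *
            besselI (-2 / Real.sqrt q) m t) +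
        (Fintype.card V : ℝ) * (1 - (q : ℝ)) *
          ∑ j ∈ Finset.Icc 1 (t / 2), ((q : ℝ) ^ j)⁻¹ * besselI (-2 / Real.sqrt q) (2 * j) t := by
  have hq0 : (q : ℝ) ≠ 0 := by positivity
  have hs : √(q : ℝ) ≠ 0 := by positivity
  have hsq : √(q : ℝ) ^ 2 = q := Real.sq_sqrt q.cast_nonneg
  have hX : (1 : Matrix V V ℝ) + (-2 / √(q : ℝ) / 2) • ((√(q : ℝ))⁻¹ • G.adjMatrix ℝ) =
      (-(q : ℝ))⁻¹ • (G.adjMatrix ℝ - (q : ℝ) • (1 : Matrix V V ℝ)) := by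
    rw [smul_sub, smul_smul, smul_smul, ← neg_inv, neg_mul, inv_mul_cancel₀ hq0, neg_one_smul,
      sub_neg_eq_add, add_comm]
    congr 2
    field_simp
    rw [hsq]
  rw [← inv_pow, ← smul_eq_mul, ← Matrix.trace_smul, ← smul_pow, ← hX, trace_one_add_smul_pow,
    Finset.sum_range_succ', ← sum_range_ite_even_succ
      (fun n => ((√(q : ℝ)) ^ n)⁻¹ * besselI (-2 / √(q : ℝ)) n t) t |>.trans
      (Finset.sum_congr rfl fun j _ => by rw [pow_mul, hsq])]
  simp only [trace_chebyshev_eq hq G hreg, NCount_zero, pow_zero, inv_one, mul_one]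
  rw [Finset.mul_sum, add_right_comm, ← Finset.sum_add_distrib, add_comm]
  congr 1
  · refine Finset.sum_congr rfl fun m _ => ?_
    split_ifs <;> ring
  · simp
end

section
/- For every complex number c the discrete I-Bessel function satisfies the forward-difference identities: I_0^c(t+1) − I_0^c(t) = c·I_1^c(t) for every integer t ≥ 0, and I_n^c(t+1) − I_n^c(t) = (c/2)·(I_{n−1}^c(t) + I_{n+1}^c(t)) for every integer n ≥ 1 and every integer t ≥ 0. -/
open Finset

/-- The discrete `I`-Bessel function `I_n^c(t)` (complex parameter `c`). -/
noncomputable def besselIC (c : ℂ) (n t : ℕ) : ℂ :=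
  if n ≤ t then
    ∑ j ∈ Finset.range ((t - n) / 2 + 1),
      (t.factorial : ℂ) /
          ((j.factorial : ℂ) * ((t - 2 * j - n).factorial : ℂ) * ((n + j).factorial : ℂ)) *
        (c / 2) ^ (2 * j + n)
  else 0

/-- The discrete `I`-Bessel function as a sum of products of binomial coefficients, of any
sufficiently large length. -/
theorem besselIC_eq_sum_choose (c : ℂ) (n t N : ℕ) (hN : t < N) :
    besselIC c n t = ∑ j ∈ Finset.range N,
      (t.choose (n + 2 * j) : ℂ) * ((n + 2 * j).choose j : ℂ) * (c / 2) ^ (n + 2 * j) := by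
  unfold besselIC
  split_ifs with h
  · have hsub : Finset.range ((t - n) / 2 + 1) ⊆ Finset.range N :=
      Finset.range_subset_range.2 (by omega)
    rw [← Finset.sum_subset hsub]
    · refine Finset.sum_congr rfl fun j hj => ?_
      have hj' : n + 2 * j ≤ t := by
        have := Finset.mem_range.1 hj
        omega
      rw [Nat.cast_choose ℂ hj', Nat.cast_choose ℂ (show j ≤ n + 2 * j by omega),
        show t - (n + 2 * j) = t - 2 * j - n by omega, show n + 2 * j - j = n + j by omega,
        add_comm (2 * j) n]
      have h1 : ((n + 2 * j).factorial : ℂ) ≠ 0 := by exact_mod_cast Nat.factorial_ne_zero _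
      field_simp
    · intro j _ hj
      rw [Nat.choose_eq_zero_of_lt (by rw [Finset.mem_range] at hj; omega)]
      simp
  · refine (Finset.sum_eq_zero fun j _ => ?_).symm
    rw [Nat.choose_eq_zero_of_lt (by omega)]
    simp

theorem besselIC_zero_succ_sub (c : ℂ) (t : ℕ) :
    besselIC c 0 (t + 1) - besselIC c 0 t = c * besselIC c 1 t := by
  rw [besselIC_eq_sum_choose c 0 (t + 1) (t + 2) (by omega),
    besselIC_eq_sum_choose c 0 t (t + 2) (by omega),
    besselIC_eq_sum_choose c 1 t (t + 1) (by omega),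
    Finset.sum_range_succ' _ (t + 1), Finset.sum_range_succ' _ (t + 1), Finset.mul_sum]
  simp only [mul_zero, add_zero, Nat.choose_zero_right]
  rw [add_sub_add_right_eq_sub, ← Finset.sum_sub_distrib]
  refine Finset.sum_congr rfl fun j _ => ?_
  have hcentral : (2 * j + 1 + 1).choose (j + 1) = 2 * (2 * j + 1).choose j := by
    rw [Nat.choose_succ_succ, Nat.choose_symm_half]
    ring
  rw [show 0 + 2 * (j + 1) = 2 * j + 1 + 1 by ring, show 1 + 2 * j = 2 * j + 1 by ring,
    hcentral, Nat.choose_succ_succ]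
  push_cast
  ring

theorem besselIC_succ_succ_sub (c : ℂ) (m t : ℕ) :
    besselIC c (m + 1) (t + 1) - besselIC c (m + 1) t =
      c / 2 * (besselIC c m t + besselIC c (m + 2) t) := by
  rw [besselIC_eq_sum_choose c (m + 1) (t + 1) (t + 2) (by omega),
    besselIC_eq_sum_choose c (m + 1) t (t + 2) (by omega),
    besselIC_eq_sum_choose c m t (t + 2) (by omega),
    besselIC_eq_sum_choose c (m + 2) t (t + 1) (by omega), ← Finset.sum_sub_distrib,
    Finset.sum_range_succ' _ (t + 1), Finset.sum_range_succ' _ (t + 1),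
    add_right_comm (Finset.sum _ _), ← Finset.sum_add_distrib, mul_add, Finset.mul_sum]
  congr 1
  · refine Finset.sum_congr rfl fun j _ => ?_
    rw [show m + 1 + 2 * (j + 1) = m + 2 * j + 2 + 1 by ring,
      show m + 2 * (j + 1) = m + 2 * j + 2 by ring, show m + 2 + 2 * j = m + 2 * j + 2 by ring,
      Nat.choose_succ_succ t, Nat.choose_succ_succ (m + 2 * j + 2) j]
    push_cast
    ring
  · simp only [mul_zero, add_zero, Nat.choose_zero_right, Nat.choose_succ_succ t]
    push_cast
    ring

theorem stmt8 (c : ℂ) :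
    (∀ t : ℕ, besselIC c 0 (t + 1) - besselIC c 0 t = c * besselIC c 1 t) ∧
    (∀ n : ℕ, 1 ≤ n → ∀ t : ℕ,
      besselIC c n (t + 1) - besselIC c n t =
        c / 2 * (besselIC c (n - 1) t + besselIC c (n + 1) t)) := by
  refine ⟨besselIC_zero_succ_sub c, fun n hn t => ?_⟩
  obtain ⟨m, rfl⟩ := Nat.exists_eq_add_of_le' hn
  exact besselIC_succ_succ_sub c m t
end

section
/- For all integers t, n with 0 ≤ n ≤ t and every complex number c, ((−c/2)^n · (−t)_n / n!) · ₂F₁((n−t)/2, (n−t)/2 + 1/2; n+1; c²) = Σ_{j=0}^{⌊(t−n)/2⌋} t!/(j!·(t−2j−n)!·(n+j)!)·(c/2)^{2j+n}, where the hypergeometric series terminates because one of its first two parameters is a non-positive integer. -/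
open Finset Polynomial

/-- The duplication formula for Pochhammer symbols. -/
theorem ascPochhammer_eval_two_mul (k : ℕ) (x : ℂ) :
    (ascPochhammer ℂ (2 * k)).eval x =
      4 ^ k * ((ascPochhammer ℂ k).eval (x / 2) * (ascPochhammer ℂ k).eval (x / 2 + 1 / 2)) := by
  induction k with
  | zero => simp
  | succ k ih =>
    rw [show 2 * (k + 1) = 2 * k + 1 + 1 by ring]
    simp only [ascPochhammer_succ_eval, ih]
    push_cast
    ring

theorem ascPochhammer_eval_neg_natCast (m k : ℕ) :
    (ascPochhammer ℂ k).eval (-(m : ℂ)) = (-1) ^ k * (m.descFactorial k : ℂ) := by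
  rw [ascPochhammer_eval_neg_eq_descPochhammer, descPochhammer_eval_eq_descFactorial]

theorem factorial_mul_ascPochhammer_eval_add_one (n k : ℕ) :
    (n.factorial : ℂ) * (ascPochhammer ℂ k).eval ((n : ℂ) + 1) = ((n + k).factorial : ℂ) := by
  rw [← Nat.factorial_mul_ascFactorial, ← ascPochhammer_nat_eq_ascFactorial]
  push_cast
  rfl

/-- The statement: for `0 ≤ n ≤ t` and complex `c`,
`((-c/2)^n (-t)_n / n!) · ₂F₁((n-t)/2, (n-t)/2 + 1/2; n+1; c²)`, where the (terminating)
hypergeometric series is written via its defining series, equals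
`Σ_{j=0}^{⌊(t-n)/2⌋} t!/(j!·(t-2j-n)!·(n+j)!)·(c/2)^{2j+n}`.
Pochhammer symbols `(x)_k` are `(ascPochhammer ℂ k).eval x`. -/
theorem stmt9 (t n : ℕ) (h : n ≤ t) (c : ℂ) :
    ((-c / 2) ^ n * (ascPochhammer ℂ n).eval (-(t : ℂ)) / (n.factorial : ℂ)) *
      ∑' k : ℕ,
        (ascPochhammer ℂ k).eval (((n : ℂ) - (t : ℂ)) / 2) *
            (ascPochhammer ℂ k).eval (((n : ℂ) - (t : ℂ)) / 2 + 1 / 2) /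
              ((k.factorial : ℂ) * (ascPochhammer ℂ k).eval ((n : ℂ) + 1)) * (c ^ 2) ^ k =
    ∑ j ∈ Finset.range ((t - n) / 2 + 1),
      (t.factorial : ℂ) /
          ((j.factorial : ℂ) * ((t - 2 * j - n).factorial : ℂ) * ((n + j).factorial : ℂ)) *
        (c / 2) ^ (2 * j + n) := by
  obtain ⟨m, rfl⟩ := Nat.exists_eq_add_of_le h
  have numerator (k : ℕ) :
      (ascPochhammer ℂ k).eval (((n : ℂ) - ((n + m : ℕ) : ℂ)) / 2) *
        (ascPochhammer ℂ k).eval (((n : ℂ) - ((n + m : ℕ) : ℂ)) / 2 + 1 / 2) =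
      (m.descFactorial (2 * k) : ℂ) / 4 ^ k := by
    have h4 : (4 : ℂ) ^ k ≠ 0 := pow_ne_zero k (by norm_num)
    rw [eq_div_iff h4, mul_comm, ← ascPochhammer_eval_two_mul, Nat.cast_add, sub_add_cancel_left,
      ascPochhammer_eval_neg_natCast, pow_mul]
    simp
  rw [tsum_eq_sum (s := Finset.range ((n + m - n) / 2 + 1)), Finset.mul_sum]
  · refine Finset.sum_congr rfl fun j hj => ?_
    have hjm : 2 * j ≤ m := by
      have := Finset.mem_range.mp hj
      omega
    have hn : (n.factorial : ℂ) ≠ 0 := Nat.cast_ne_zero.mpr n.factorial_ne_zero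
    have hm : (m.factorial : ℂ) ≠ 0 := Nat.cast_ne_zero.mpr m.factorial_ne_zero
    have hj' : (j.factorial : ℂ) ≠ 0 := Nat.cast_ne_zero.mpr j.factorial_ne_zero
    have hnj : ((n + j).factorial : ℂ) ≠ 0 := Nat.cast_ne_zero.mpr (n + j).factorial_ne_zero
    have hmj : ((m - 2 * j).factorial : ℂ) ≠ 0 :=
      Nat.cast_ne_zero.mpr (m - 2 * j).factorial_ne_zero
    have denominator : (ascPochhammer ℂ j).eval ((n : ℂ) + 1) =
        ((n + j).factorial : ℂ) / (n.factorial : ℂ) := by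
      rw [eq_div_iff hn, mul_comm, factorial_mul_ascPochhammer_eval_add_one]
    have desc_m : (m.descFactorial (2 * j) : ℂ) =
        (m.factorial : ℂ) / ((m - 2 * j).factorial : ℂ) := by
      rw [eq_div_iff hmj, mul_comm]
      exact_mod_cast Nat.factorial_mul_descFactorial hjm
    have desc_t : ((n + m).descFactorial n : ℂ) =
        ((n + m).factorial : ℂ) / (m.factorial : ℂ) := by
      rw [eq_div_iff hm, mul_comm]
      have := Nat.factorial_mul_descFactorial h
      rw [Nat.add_sub_cancel_left] at this
      exact_mod_cast this
    have sign : (-c / 2) ^ n * (-1) ^ n = (c / 2) ^ n := by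
      rw [← mul_pow]
      ring
    have power : (c ^ 2) ^ j / 4 ^ j = (c / 2) ^ (2 * j) := by
      rw [← div_pow, pow_mul, div_pow c]
      norm_num
    rw [numerator, denominator, desc_m, ascPochhammer_eval_neg_natCast, desc_t,
      show n + m - 2 * j - n = m - 2 * j by omega, pow_add, ← sign, ← power]
    field_simp
  · intro k hk
    have hmk : m < 2 * k := by
      rw [Finset.mem_range] at hk
      omega
    rw [numerator, Nat.descFactorial_of_lt hmk]
    simp
end

section
/- For fixed integers r, t with 0 ≤ r ≤ t, the ratio ((−q)^t · q^{−r/2} · I_r^{−2/√q}(t)) / ((−1)^{t−r} · C(t,r) · q^{t−r}) tends to 1 as the positive integer q tends to infinity, where C(t,r) is the binomial coefficient. -/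
open Finset Filter

/-- Each normalized summand of `besselI` is a constant times a power of `q⁻¹`, where `q = s ^ 2`. -/
lemma normalized_summand_eq (r m j : ℕ) (A C s : ℝ) (hs : s ≠ 0) :
    ((-(s ^ 2)) ^ (r + m) * (s ^ r)⁻¹ * (A * (-2 / s / 2) ^ (2 * j + r))) /
        ((-1 : ℝ) ^ m * C * (s ^ 2) ^ m) =
      A / C * ((s ^ 2)⁻¹) ^ j := by
  have hsign : (-1 : ℝ) ^ m ≠ 0 := by simp
  have hr : (-1 : ℝ) ^ r * (-1) ^ r = 1 := by rw [← mul_pow]; simp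
  have hneg : -2 / s / 2 = -1 * s⁻¹ := by ring
  have hj : (-1 * s⁻¹) ^ (2 * j + r) = (-1) ^ r * ((s ^ 2)⁻¹) ^ j * (s ^ r)⁻¹ := by
    rw [mul_pow, pow_add, pow_add, pow_mul, pow_mul, inv_pow s 2, inv_pow s r]
    norm_num
    ring
  rw [hneg, hj, neg_eq_neg_one_mul (s ^ 2), mul_pow, pow_add, pow_add]
  have hcancel : (s ^ 2) ^ r * (s ^ r)⁻¹ * (s ^ r)⁻¹ = 1 := by
    field_simp
    ring
  calc
    _ = ((-1 : ℝ) ^ r * (-1) ^ r) * ((s ^ 2) ^ r * (s ^ r)⁻¹ * (s ^ r)⁻¹) *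
          (((-1 : ℝ) ^ m * ((-1) ^ m)⁻¹) * ((s ^ 2) ^ m * ((s ^ 2) ^ m)⁻¹)) *
          (A / C * ((s ^ 2)⁻¹) ^ j) := by
        simp only [div_eq_mul_inv, mul_inv]
        ring
    _ = _ := by
        rw [hr, hcancel, mul_inv_cancel₀ hsign, mul_inv_cancel₀ (by positivity)]
        ring

theorem stmt10 (r t : ℕ) (h : r ≤ t) :
    Tendsto (fun q : ℕ =>
      ((-(q : ℝ)) ^ t * ((Real.sqrt q) ^ r)⁻¹ * besselI (-2 / Real.sqrt q) r t) /
        ((-1 : ℝ) ^ (t - r) * (t.choose r : ℝ) * (q : ℝ) ^ (t - r)))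
      atTop (nhds 1) := by
  obtain ⟨m, rfl⟩ := Nat.exists_eq_add_of_le h
  let a : ℕ → ℝ := fun j => ((r + m).factorial : ℝ) /
    ((j.factorial : ℝ) * ((r + m - 2 * j - r).factorial : ℝ) * ((r + j).factorial : ℝ)) /
      ((r + m).choose r : ℝ)
  let f : ℝ → ℝ := fun x => ∑ j ∈ Finset.range ((r + m - r) / 2 + 1), a j * x ^ j
  have hf : Continuous f := by fun_prop
  have hf0 : f 0 = 1 := by
    have ha : a 0 = 1 := by
      have hc : ((r + m).choose r : ℝ) * (r.factorial * m.factorial) = (r + m).factorial := by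
        have := Nat.choose_mul_factorial_mul_factorial h
        rw [Nat.add_sub_cancel_left] at this
        rw [← mul_assoc]
        exact_mod_cast this
      have hpos : ((r + m).choose r : ℝ) ≠ 0 := by
        exact_mod_cast (Nat.choose_pos h).ne'
      simp only [a, ← hc]
      simp
      field_simp
    simp [f, Finset.sum_range_succ', ha]
  have hlim : Tendsto (fun q : ℕ => f ((q : ℝ)⁻¹)) atTop (nhds 1) := by
    rw [← hf0]
    exact (hf.tendsto 0).comp tendsto_inv_atTop_nhds_zero_nat
  refine hlim.congr' ?_
  filter_upwards [eventually_gt_atTop 0] with q hq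
  have hs : Real.sqrt q ≠ 0 := by positivity
  have hq2 : (q : ℝ) = Real.sqrt q ^ 2 := (Real.sq_sqrt q.cast_nonneg).symm
  simp only [f, a, besselI, if_pos h, Finset.mul_sum, Finset.sum_div]
  refine Finset.sum_congr rfl fun j _ => ?_
  generalize Real.sqrt q = s at hs hq2 ⊢
  rw [hq2, Nat.add_sub_cancel_left, normalized_summand_eq _ _ _ _ _ _ hs]
end

section
/- For every nonzero real number c and every fixed n ∈ ℕ, the ratio I_n^c(t) · √(2π|c|t) / ( (sgn c)^n · (1+|c|)^{t+1/2} ) tends to 1 as the integer t tends to infinity, where sgn(c) denotes the sign of c. -/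
open Finset Filter

theorem integral_exp_int_mul_I (m : ℤ) :
    ∫ θ in (-Real.pi)..Real.pi, Complex.exp (m * θ * Complex.I) =
      if m = 0 then 2 * (Real.pi : ℂ) else 0 := by
  split_ifs with h
  · subst h; simp; ring
  · have hm : (m : ℂ) * Complex.I ≠ 0 := by simp [h]
    have := integral_exp_mul_complex (a := -Real.pi) (b := Real.pi) hm
    rw [show (fun θ : ℝ => Complex.exp (m * θ * Complex.I)) =
      fun θ : ℝ => Complex.exp (m * Complex.I * θ) by ext; ring_nf, this,
      div_eq_zero_iff, sub_eq_zero]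
    left
    rw [Complex.exp_eq_exp_iff_exists_int]
    exact ⟨m, by push_cast; ring⟩

theorem sum_sum_choose_mul_choose (c : ℝ) (n t : ℕ) :
    ∑ k ∈ range (t + 1), ∑ m ∈ range (k + 1),
        (if 2 * m = k + n then (c / 2) ^ k * (t.choose k) * (k.choose m) else 0) =
      besselI c n t := by
  unfold besselI
  split_ifs with hnt
  · rw [Finset.sum_sigma', ← Finset.sum_filter]
    refine Finset.sum_nbij' (fun p => p.2 - n) (fun j => ⟨2 * j + n, n + j⟩) ?_ ?_ ?_ ?_ ?_
    · rintro ⟨k, m⟩ h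
      simp at h ⊢
      omega
    · intro j h
      simp at h ⊢
      omega
    · rintro ⟨k, m⟩ h
      simp at h ⊢
      omega
    · intro j h
      simp
    · rintro ⟨k, m⟩ h
      simp at h ⊢
      obtain ⟨j, rfl⟩ : ∃ j, m = n + j := ⟨m - n, by omega⟩
      obtain rfl : k = 2 * j + n := by omega
      rw [Nat.cast_choose ℝ (by omega : 2 * j + n ≤ t),
        Nat.cast_choose ℝ (by omega : n + j ≤ 2 * j + n),
        show 2 * j + n - (n + j) = j by omega, show n + j - n = j by omega,
        show t - (2 * j + n) = t - 2 * j - n by omega]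
      have := Nat.factorial_ne_zero (2 * j + n)
      field_simp
  · refine Finset.sum_eq_zero fun k hk => Finset.sum_eq_zero fun m hm => if_neg ?_
    simp at hk hm
    omega

theorem integral_one_add_mul_cos_pow_mul_exp (c : ℝ) (n t : ℕ) :
    ∫ θ in (-Real.pi)..Real.pi,
        (1 + c * Real.cos θ : ℂ) ^ t * Complex.exp (-(n * θ * Complex.I)) =
      2 * Real.pi * ((∑ k ∈ range (t + 1), ∑ m ∈ range (k + 1),
        (if 2 * m = k + n then (c / 2) ^ k * (t.choose k) * (k.choose m) else 0) : ℝ) : ℂ) := by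
  have expand (θ : ℝ) : (1 + c * Real.cos θ : ℂ) ^ t * Complex.exp (-(n * θ * Complex.I)) =
      ∑ k ∈ range (t + 1), ∑ m ∈ range (k + 1), ((c / 2 : ℂ) ^ k * (t.choose k) * (k.choose m)) *
        Complex.exp (((2 * m - k - n : ℤ) : ℂ) * θ * Complex.I) := by
    rw [add_comm, add_pow, Finset.sum_mul]
    refine Finset.sum_congr rfl fun k hk => ?_
    rw [Complex.ofReal_cos, Complex.cos, mul_div_assoc', ← div_mul_eq_mul_div, mul_pow, add_pow,
      Finset.mul_sum, Finset.sum_mul, Finset.sum_mul, Finset.sum_mul]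
    refine Finset.sum_congr rfl fun m hm => ?_
    have hmk : m ≤ k := by simp at hm; omega
    rw [← Complex.exp_nat_mul, ← Complex.exp_nat_mul, Nat.cast_sub hmk]
    rw [show (((2 * m - k - n : ℤ) : ℂ) * θ * Complex.I) =
      m * (θ * Complex.I) + (k - m) * (-θ * Complex.I) + (-(n * θ * Complex.I)) by
        push_cast; ring, Complex.exp_add, Complex.exp_add]
    ring
  simp_rw [expand]
  rw [intervalIntegral.integral_finsetSum]
  · rw [Complex.ofReal_sum, Finset.mul_sum]
    refine Finset.sum_congr rfl fun k hk => ?_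
    rw [intervalIntegral.integral_finsetSum, Complex.ofReal_sum, Finset.mul_sum]
    · refine Finset.sum_congr rfl fun m hm => ?_
      rw [intervalIntegral.integral_const_mul, integral_exp_int_mul_I]
      have : (2 * m - k - n : ℤ) = 0 ↔ 2 * m = k + n := by omega
      simp only [this]
      split_ifs <;> push_cast <;> ring
    · intro m hm
      exact Continuous.intervalIntegrable (by fun_prop) _ _
  · intro k hk
    exact Continuous.intervalIntegrable (by fun_prop) _ _

theorem integral_one_add_mul_cos_pow_mul_cos (c : ℝ) (n t : ℕ) :
    ∫ θ in (-Real.pi)..Real.pi, (1 + c * Real.cos θ) ^ t * Real.cos (n * θ) =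
      2 * Real.pi * ∑ k ∈ range (t + 1), ∑ m ∈ range (k + 1),
        (if 2 * m = k + n then (c / 2) ^ k * (t.choose k) * (k.choose m) else 0) := by
  have h := congrArg Complex.re (integral_one_add_mul_cos_pow_mul_exp c n t)
  have h2 := Complex.reCLM.intervalIntegral_comp_comm (μ := MeasureTheory.volume)
    (a := -Real.pi) (b := Real.pi)
    (f := fun θ : ℝ => (1 + c * Real.cos θ : ℂ) ^ t * Complex.exp (-(n * θ * Complex.I)))
    (Continuous.intervalIntegrable (by fun_prop) _ _)
  rw [Complex.reCLM_apply, h] at h2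
  have hr : ∀ S : ℝ, (2 * (Real.pi : ℂ) * (S : ℂ)).re = 2 * Real.pi * S := by
    intro S; norm_cast
  rw [hr] at h2
  rw [← h2]
  refine intervalIntegral.integral_congr fun θ _ => ?_
  simp only [Complex.reCLM_apply]
  rw [show (1 + c * Real.cos θ : ℂ) ^ t = (((1 + c * Real.cos θ) ^ t : ℝ) : ℂ) by push_cast; rfl,
    Complex.re_ofReal_mul,
    show (-(n * θ * Complex.I) : ℂ) = ((-(n * θ) : ℝ) : ℂ) * Complex.I by push_cast; ring,
    Complex.exp_ofReal_mul_I_re, Real.cos_neg]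

theorem besselI_eq_sign_pow_mul_besselI_abs {c : ℝ} (hc : c ≠ 0) (n t : ℕ) :
    besselI c n t = Real.sign c ^ n * besselI |c| n t := by
  unfold besselI
  split_ifs
  · rw [Finset.mul_sum]
    refine Finset.sum_congr rfl fun j _ => ?_
    rcases lt_or_gt_of_ne hc with h | h
    · have hsign : ((-1 : ℝ) ^ n) * (-1) ^ (2 * j + n) = 1 := by
        rw [← pow_add, Even.neg_one_pow ⟨j + n, by ring⟩]
      rw [Real.sign_of_neg h, abs_of_neg h, neg_div, neg_pow (c / 2), mul_left_comm,
        ← mul_assoc ((-1 : ℝ) ^ n), hsign, one_mul]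
    · rw [Real.sign_of_pos h, abs_of_pos h]; simp
  · simp

theorem abs_one_add_mul_cos_div_le {c : ℝ} (hc : 0 < c) {θ : ℝ} (hθ : |θ| ≤ Real.pi) :
    |(1 + c * Real.cos θ) / (1 + c)| ≤
      Real.exp (-(2 * min c 1 / (Real.pi ^ 2 * (1 + c)) * θ ^ 2)) := by
  have hpi := Real.pi_pos
  have hcos := Real.cos_le_one_sub_mul_cos_sq hθ
  have hcos' := Real.neg_one_le_cos θ
  set x := 2 / Real.pi ^ 2 * θ ^ 2 with hx
  have hx0 : 0 ≤ x := by positivity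
  have hx2 : x ≤ 2 := by linarith
  refine le_trans ?_ (Real.one_sub_le_exp_neg _)
  rw [show 2 * min c 1 / (Real.pi ^ 2 * (1 + c)) * θ ^ 2 = min c 1 * x / (1 + c) by
    rw [hx]; field_simp, abs_div, abs_of_pos (by linarith : 0 < 1 + c),
    div_le_iff₀ (by linarith), sub_mul, div_mul_cancel₀ _ (by linarith), abs_le]
  have h1 : min c 1 * x ≤ c * x := mul_le_mul_of_nonneg_right (min_le_left _ _) hx0
  have h2 : min c 1 * x ≤ 1 * x := mul_le_mul_of_nonneg_right (min_le_right _ _) hx0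
  constructor <;> nlinarith

theorem tendsto_mul_cos_div_sqrt_sub_one (u : ℝ) :
    Tendsto (fun t : ℕ => (t : ℝ) * (Real.cos (u / √t) - 1)) atTop (nhds (-(u ^ 2 / 2))) := by
  have hz : Tendsto (fun t : ℕ => u / √(t : ℝ) / 2) atTop (nhds 0) := by
    have := (tendsto_const_nhds (x := u)).div_atTop
      (Real.tendsto_sqrt_atTop.comp tendsto_natCast_atTop_atTop)
    simpa using this.div_const 2
  have hs := (Real.continuous_sinc.tendsto 0).comp hz
  rw [Real.sinc_zero] at hs
  have h := (hs.pow 2).const_mul (-(u ^ 2 / 2))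
  rw [one_pow, mul_one] at h
  refine h.congr' ?_
  filter_upwards [eventually_gt_atTop 0] with t ht
  have ht' : (0 : ℝ) < t := by exact_mod_cast ht
  have hst : 0 < √(t : ℝ) := Real.sqrt_pos.2 ht'
  simp only [Function.comp_apply]
  rcases eq_or_ne u 0 with rfl | hu
  · simp
  · rw [Real.sinc_of_ne_zero (by positivity)]
    have h1 := Real.cos_sq (u / √t / 2)
    have h2 := Real.sin_sq_add_cos_sq (u / √t / 2)
    rw [mul_div_cancel₀ _ two_ne_zero] at h1
    rw [show Real.cos (u / √t) - 1 = -2 * Real.sin (u / √t / 2) ^ 2 by linarith]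
    field_simp
    rw [Real.sq_sqrt ht'.le]
    ring

theorem tendsto_one_add_mul_cos_div_pow {c : ℝ} (hc : 0 < c) (u : ℝ) :
    Tendsto (fun t : ℕ => ((1 + c * Real.cos (u / √t)) / (1 + c)) ^ t) atTop
      (nhds (Real.exp (-(c / (2 * (1 + c))) * u ^ 2))) := by
  have h := Real.tendsto_one_add_pow_exp_of_tendsto
    (g := fun t : ℕ => c / (1 + c) * (Real.cos (u / √t) - 1))
    (t := -(c / (2 * (1 + c))) * u ^ 2) <| by
      have := (tendsto_mul_cos_div_sqrt_sub_one u).const_mul (c / (1 + c))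
      convert this using 2
      · ring
      · field_simp
  refine h.congr fun t => ?_
  congr 1
  field_simp
  ring

theorem tendsto_sqrt_mul_integral {c : ℝ} (hc : 0 < c) (n : ℕ) :
    Tendsto (fun t : ℕ => √t * ∫ θ in (-Real.pi)..Real.pi,
        ((1 + c * Real.cos θ) / (1 + c)) ^ t * Real.cos (n * θ)) atTop
      (nhds √(Real.pi / (c / (2 * (1 + c))))) := by
  have hpi := Real.pi_pos
  set κ := 2 * min c 1 / (Real.pi ^ 2 * (1 + c)) with hκ
  have hκ0 : 0 < κ := by
    have : 0 < min c 1 := lt_min hc one_pos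
    positivity
  let F (t : ℕ) : ℝ → ℝ := (Set.Ioc (-(Real.pi * √t)) (Real.pi * √t)).indicator fun u =>
    ((1 + c * Real.cos (u / √t)) / (1 + c)) ^ t * Real.cos (n * (u / √t))
  have key : Tendsto (fun t => ∫ u, F t u) atTop
      (nhds (∫ u : ℝ, Real.exp (-(c / (2 * (1 + c))) * u ^ 2))) := by
    refine MeasureTheory.tendsto_integral_filter_of_dominated_convergence
      (fun u => Real.exp (-κ * u ^ 2)) ?_ ?_ (integrable_exp_neg_mul_sq hκ0) ?_
    · refine Eventually.of_forall fun t => ?_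
      exact (Continuous.aestronglyMeasurable (by fun_prop)).indicator measurableSet_Ioc
    · filter_upwards [eventually_gt_atTop 0] with t ht
      refine Eventually.of_forall fun u => ?_
      have ht' : (0 : ℝ) < t := by exact_mod_cast ht
      have hst : 0 < √(t : ℝ) := Real.sqrt_pos.2 ht'
      by_cases hu : u ∈ Set.Ioc (-(Real.pi * √t)) (Real.pi * √t)
      · simp only [F, Set.indicator_of_mem hu, norm_mul, norm_pow, Real.norm_eq_abs]
        have hθ : |u / √t| ≤ Real.pi := by
          rw [abs_div, abs_of_pos hst, div_le_iff₀ hst, abs_le]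
          exact ⟨hu.1.le, hu.2⟩
        calc _ ≤ Real.exp (-(κ * (u / √t) ^ 2)) ^ t * 1 := by
              gcongr
              · exact abs_one_add_mul_cos_div_le hc hθ
              · exact Real.abs_cos_le_one _
          _ = _ := by
              rw [mul_one, ← Real.exp_nat_mul, div_pow, Real.sq_sqrt ht'.le]
              congr 1
              field_simp
      · simp only [F, Set.indicator_of_notMem hu, norm_zero]
        positivity
    · refine Eventually.of_forall fun u => ?_
      have hz : Tendsto (fun t : ℕ => u / √(t : ℝ)) atTop (nhds 0) :=
        (tendsto_const_nhds (x := u)).div_atTop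
          (Real.tendsto_sqrt_atTop.comp tendsto_natCast_atTop_atTop)
      have hcos : Tendsto (fun t : ℕ => Real.cos (n * (u / √(t : ℝ)))) atTop (nhds 1) := by
        have := (Real.continuous_cos.tendsto (n * 0)).comp (hz.const_mul (n : ℝ))
        simpa [Function.comp_def] using this
      have h := (tendsto_one_add_mul_cos_div_pow hc u).mul hcos
      rw [mul_one] at h
      refine h.congr' ?_
      have hlarge : Tendsto (fun t : ℕ => Real.pi * √(t : ℝ)) atTop atTop :=
        (Real.tendsto_sqrt_atTop.comp tendsto_natCast_atTop_atTop).const_mul_atTop hpi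
      filter_upwards [hlarge.eventually_gt_atTop |u|] with t ht
      have hu : u ∈ Set.Ioc (-(Real.pi * √t)) (Real.pi * √t) :=
        ⟨(abs_lt.1 ht).1, (abs_lt.1 ht).2.le⟩
      simp only [F, Set.indicator_of_mem hu]
  rw [integral_gaussian] at key
  refine key.congr' ?_
  filter_upwards [eventually_gt_atTop 0] with t ht
  have ht' : (0 : ℝ) < t := by exact_mod_cast ht
  have hst : 0 < √(t : ℝ) := Real.sqrt_pos.2 ht'
  rw [MeasureTheory.integral_indicator measurableSet_Ioc,
    ← intervalIntegral.integral_of_le (by nlinarith),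
    intervalIntegral.integral_comp_div
      (fun θ => ((1 + c * Real.cos θ) / (1 + c)) ^ t * Real.cos (n * θ)) hst.ne',
    smul_eq_mul, neg_div, mul_div_cancel_right₀ _ hst.ne']

theorem tendsto_besselI_of_pos {c : ℝ} (hc : 0 < c) (n : ℕ) :
    Tendsto (fun t : ℕ =>
      besselI c n t * √(2 * Real.pi * c * t) / (1 + c) ^ ((t : ℝ) + 1 / 2)) atTop (nhds 1) := by
  have hpi := Real.pi_pos
  have h := (tendsto_sqrt_mul_integral hc n).const_mul
    (√(2 * Real.pi * c) / (2 * Real.pi * √(1 + c)))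
  have hlim : √(2 * Real.pi * c) / (2 * Real.pi * √(1 + c)) *
      √(Real.pi / (c / (2 * (1 + c)))) = 1 := by
    rw [div_mul_eq_mul_div, ← Real.sqrt_mul (by positivity),
      show 2 * Real.pi * c * (Real.pi / (c / (2 * (1 + c)))) = (2 * Real.pi) ^ 2 * (1 + c) by
        field_simp, Real.sqrt_mul (by positivity), Real.sqrt_sq (by positivity)]
    exact div_self (by positivity)
  rw [hlim] at h
  refine h.congr fun t => ?_
  simp_rw [div_pow, div_mul_eq_mul_div]
  rw [intervalIntegral.integral_div, integral_one_add_mul_cos_pow_mul_cos,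
    sum_sum_choose_mul_choose, Real.rpow_add (by linarith), Real.rpow_natCast,
    ← Real.sqrt_eq_rpow, Real.sqrt_mul (by positivity) (t : ℝ)]
  field_simp

theorem stmt11 (c : ℝ) (hc : c ≠ 0) (n : ℕ) :
    Tendsto (fun t : ℕ =>
      besselI c n t * Real.sqrt (2 * Real.pi * |c| * t) /
        ((Real.sign c) ^ n * (1 + |c|) ^ ((t : ℝ) + 1 / 2)))
      atTop (nhds 1) := by
  have hs : Real.sign c ^ n ≠ 0 := pow_ne_zero _ (mt Real.sign_eq_zero_iff.1 hc)
  refine (tendsto_besselI_of_pos (abs_pos.2 hc) n).congr fun t => ?_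
  rw [besselI_eq_sign_pow_mul_besselI_abs hc, mul_assoc (_ ^ n), mul_div_mul_left _ _ hs]
end

section
/- For real d > 0 with d ≠ 1/2 and n ∈ ℤ, define u(n,t) = (1−2d)^t · I_{|n|}^{2d/(1−2d)}(t) for t ∈ ℕ. Then for fixed n: if 0 < d < 1/2, u(n,t) · 2√(πdt) tends to 1 as t → ∞; and if d > 1/2, u(n,t) · 2√(πdt) / ((−1)^{n+t} (4d−1)^{t+1/2}) tends to 1 as t → ∞. -/
open Finset Filter

/-- The solution `u(n,t) = (1-2d)^t I_{|n|}^{2d/(1-2d)}(t)` of the discrete-time diffusion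
equation on `ℤ`. -/
noncomputable def uSol (d : ℝ) (n : ℤ) (t : ℕ) : ℝ :=
  (1 - 2 * d) ^ t * besselI (2 * d / (1 - 2 * d)) n.natAbs t


theorem two_mul_cos_pow_mul_cos (k : ℕ) (θ φ : ℝ) :
    (2 * Real.cos θ) ^ k * Real.cos φ =
      ∑ j ∈ range (k + 1), (k.choose j : ℝ) * Real.cos (((k : ℝ) - 2 * j) * θ + φ) := by
  have h : ((2 * Real.cos θ) ^ k * Real.cos φ : ℝ) =
      ((Complex.exp (θ * Complex.I) + Complex.exp (-(θ * Complex.I))) ^ k *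
        Complex.exp (φ * Complex.I)).re := by
    have h1 : Complex.exp (θ * Complex.I) + Complex.exp (-(θ * Complex.I)) =
        ((2 * Real.cos θ : ℝ) : ℂ) := by
      push_cast
      rw [Complex.two_cos, neg_mul]
    rw [h1, ← Complex.ofReal_pow, Complex.re_ofReal_mul, Complex.exp_ofReal_mul_I_re]
  rw [h, add_comm, add_pow, sum_mul, Complex.re_sum]
  refine sum_congr rfl fun j hj => ?_
  have hj' : j ≤ k := Nat.lt_succ_iff.mp (mem_range.mp hj)
  have e : Complex.exp (-(θ * Complex.I)) ^ j * Complex.exp (θ * Complex.I) ^ (k - j) *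
        (k.choose j : ℂ) * Complex.exp (φ * Complex.I) =
      ((k.choose j : ℝ) : ℂ) *
        Complex.exp (((((k : ℝ) - 2 * j) * θ + φ : ℝ) : ℂ) * Complex.I) := by
    rw [← Complex.exp_nat_mul, ← Complex.exp_nat_mul, mul_right_comm, ← Complex.exp_add,
      ← Complex.exp_add, mul_comm]
    push_cast [Nat.cast_sub hj']
    congr 2
    ring
  rw [e, Complex.re_ofReal_mul, Complex.exp_ofReal_mul_I_re]

theorem integral_cos_int_mul (m : ℤ) :
    ∫ θ in (0 : ℝ)..Real.pi, Real.cos (m * θ) = if m = 0 then Real.pi else 0 := by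
  split_ifs with h
  · simp [h]
  · rw [intervalIntegral.integral_comp_mul_left (fun x => Real.cos x) (by exact_mod_cast h)]
    simp [Real.sin_int_mul_pi]

theorem integral_two_mul_cos_pow_mul_cos (k n : ℕ) :
    ∫ θ in (0 : ℝ)..Real.pi, (2 * Real.cos θ) ^ k * Real.cos (n * θ) =
      ∑ j ∈ range (k + 1), (k.choose j : ℝ) * if k = 2 * j + n then Real.pi else 0 := by
  have h : ∀ θ : ℝ, (2 * Real.cos θ) ^ k * Real.cos (n * θ) =
      ∑ j ∈ range (k + 1),
        (k.choose j : ℝ) * Real.cos (((k - 2 * j - n : ℤ) : ℝ) * θ) := by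
    intro θ
    rw [← Real.cos_neg (n * θ), two_mul_cos_pow_mul_cos]
    refine sum_congr rfl fun j _ => ?_
    congr 2
    push_cast
    ring
  simp_rw [h]
  rw [intervalIntegral.integral_finsetSum]
  · refine sum_congr rfl fun j _ => ?_
    rw [intervalIntegral.integral_const_mul, integral_cos_int_mul]
    congr 1
    exact if_congr (by omega) rfl rfl
  · intro j _
    exact Continuous.intervalIntegrable (by fun_prop) _ _

theorem integral_add_mul_cos_pow_mul_cos (a d : ℝ) (n t : ℕ) :
    ∫ θ in (0 : ℝ)..Real.pi, (a + 2 * d * Real.cos θ) ^ t * Real.cos (n * θ) =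
      ∑ j ∈ range (t + 1), if 2 * j + n ≤ t then
        Real.pi * ((t.choose (2 * j + n) : ℝ) * ((2 * j + n).choose j : ℝ) *
          a ^ (t - (2 * j + n)) * d ^ (2 * j + n)) else 0 := by
  have h : ∀ θ : ℝ, (a + 2 * d * Real.cos θ) ^ t * Real.cos (n * θ) =
      ∑ k ∈ range (t + 1), (t.choose k * a ^ (t - k) * d ^ k) *
        ((2 * Real.cos θ) ^ k * Real.cos (n * θ)) := by
    intro θ
    rw [add_comm, add_pow, sum_mul]
    refine sum_congr rfl fun k _ => ?_
    rw [show 2 * d * Real.cos θ = d * (2 * Real.cos θ) by ring, mul_pow]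
    ring
  simp_rw [h]
  rw [intervalIntegral.integral_finsetSum
    fun k _ => Continuous.intervalIntegrable (by fun_prop) _ _]
  have h2 : ∀ k ∈ range (t + 1),
      ∫ θ in (0 : ℝ)..Real.pi, (t.choose k * a ^ (t - k) * d ^ k) *
        ((2 * Real.cos θ) ^ k * Real.cos (n * θ)) =
      ∑ j ∈ range (t + 1), if k = 2 * j + n then
        Real.pi * ((t.choose k : ℝ) * (k.choose j : ℝ) * a ^ (t - k) * d ^ k) else 0 := by
    intro k hk
    rw [intervalIntegral.integral_const_mul, integral_two_mul_cos_pow_mul_cos, mul_sum]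
    have hk' : range (k + 1) ⊆ range (t + 1) := by
      intro x; simp only [mem_range] at hk ⊢; omega
    rw [← sum_subset hk']
    · refine sum_congr rfl fun j _ => ?_
      split_ifs <;> ring
    · intro j _ hj
      rw [Nat.choose_eq_zero_of_lt (show k < j by simpa using hj)]
      simp
  rw [sum_congr rfl h2, sum_comm]
  refine sum_congr rfl fun j _ => ?_
  rw [sum_ite_eq']
  exact if_congr (by simp) rfl rfl

theorem pi_mul_pow_mul_besselI (a d : ℝ) (ha : a ≠ 0) (n t : ℕ) :
    Real.pi * (a ^ t * besselI (2 * d / a) n t) =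
      ∫ θ in (0 : ℝ)..Real.pi, (a + 2 * d * Real.cos θ) ^ t * Real.cos (n * θ) := by
  rw [integral_add_mul_cos_pow_mul_cos, besselI, ← sum_filter]
  split_ifs with hn
  · have hs : (range (t + 1)).filter (fun j => 2 * j + n ≤ t) = range ((t - n) / 2 + 1) := by
      ext j; simp only [mem_filter, mem_range]; omega
    rw [hs, mul_sum, mul_sum]
    refine sum_congr rfl fun j hj => ?_
    have hj' : 2 * j + n ≤ t := by simp only [mem_range] at hj; omega
    rw [Nat.cast_choose ℝ hj', Nat.cast_choose ℝ (show j ≤ 2 * j + n by omega),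
      show 2 * j + n - j = n + j by omega, show t - 2 * j - n = t - (2 * j + n) by omega,
      show 2 * d / a / 2 = d / a by ring, div_pow]
    obtain ⟨m, rfl⟩ := Nat.exists_eq_add_of_le hj'
    rw [Nat.add_sub_cancel_left, pow_add]
    have := Nat.factorial_ne_zero (2 * j + n)
    field_simp
  · rw [filter_false_of_mem (fun j _ => by omega)]
    simp

theorem tendsto_natCast_mul_one_sub_cos_div_sqrt (x : ℝ) :
    Tendsto (fun t : ℕ => (t : ℝ) * (1 - Real.cos (x / √t))) atTop (nhds (x ^ 2 / 2)) := by
  have h1 : Tendsto (fun t : ℕ => x ^ 4 * (5 / 96) / (t : ℝ)) atTop (nhds 0) :=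
    tendsto_const_div_atTop_nhds_zero_nat _
  rw [tendsto_iff_norm_sub_tendsto_zero]
  refine squeeze_zero' (Eventually.of_forall fun _ => norm_nonneg _) ?_ h1
  have h2 : ∀ᶠ t : ℕ in atTop, x ^ 2 ≤ (t : ℝ) :=
    tendsto_natCast_atTop_atTop.eventually_ge_atTop _
  filter_upwards [h2, eventually_gt_atTop 0] with t ht ht0
  have ht0' : (0 : ℝ) < t := by exact_mod_cast ht0
  have hsq : (x / √t) ^ 2 = x ^ 2 / t := by rw [div_pow, Real.sq_sqrt ht0'.le]
  have hle : |x / √t| ≤ 1 := by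
    rw [← sq_le_one_iff_abs_le_one, hsq]
    exact (div_le_one ht0').mpr ht
  have hb := Real.cos_bound hle
  have h4 : |x / √t| ^ 4 = x ^ 4 / (t : ℝ) ^ 2 := by
    rw [show |x / √t| ^ 4 = (|x / √t| ^ 2) ^ 2 by ring, sq_abs, hsq]
    ring
  rw [hsq, h4] at hb
  have e : (t : ℝ) * (1 - Real.cos (x / √t)) - x ^ 2 / 2 =
      -(t * (Real.cos (x / √t) - (1 - x ^ 2 / t / 2))) := by
    field_simp
    ring
  rw [e, Real.norm_eq_abs, abs_neg, abs_mul, abs_of_pos ht0']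
  calc _ ≤ (t : ℝ) * (x ^ 4 / (t : ℝ) ^ 2 * (5 / 96)) := by gcongr
    _ = _ := by field_simp

theorem abs_one_sub_mul_one_sub_cos_le {p θ : ℝ} (hp0 : 0 < p) (hp1 : p < 1)
    (hθ : |θ| ≤ Real.pi) :
    |1 - p * (1 - Real.cos θ)| ≤
      Real.exp (-(min p (1 - p) * (2 / Real.pi ^ 2)) * θ ^ 2) := by
  have h1 := Real.cos_le_one_sub_mul_cos_sq hθ
  have h2 := Real.neg_one_le_cos θ
  have hc := Real.cos_le_one θ
  set q := min p (1 - p) with hq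
  have hq0 : 0 < q := lt_min hp0 (by linarith)
  have hqp : q ≤ p := min_le_left _ _
  have hqp' : q ≤ 1 - p := min_le_right _ _
  calc |1 - p * (1 - Real.cos θ)| ≤ 1 - q * (1 - Real.cos θ) := by
        rw [abs_le]
        constructor <;> nlinarith
    _ ≤ 1 - q * (2 / Real.pi ^ 2 * θ ^ 2) := by
        have : 2 / Real.pi ^ 2 * θ ^ 2 ≤ 1 - Real.cos θ := by linarith
        have := mul_le_mul_of_nonneg_left this hq0.le
        linarith
    _ ≤ Real.exp (-(q * (2 / Real.pi ^ 2)) * θ ^ 2) := by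
        have := Real.add_one_le_exp (-(q * (2 / Real.pi ^ 2)) * θ ^ 2)
        linarith

theorem tendsto_sqrt_mul_integral_one_sub_pow_mul_cos {p : ℝ} (hp0 : 0 < p) (hp1 : p < 1)
    (n : ℕ) :
    Tendsto (fun t : ℕ => √t *
        ∫ θ in (0 : ℝ)..Real.pi, (1 - p * (1 - Real.cos θ)) ^ t * Real.cos (n * θ))
      atTop (nhds (√(Real.pi / (p / 2)) / 2)) := by
  set k : ℝ := min p (1 - p) * (2 / Real.pi ^ 2) with hk
  have hk0 : 0 < k := mul_pos (lt_min hp0 (by linarith)) (by positivity)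
  set f : ℕ → ℝ → ℝ := fun t θ => (1 - p * (1 - Real.cos θ)) ^ t * Real.cos (n * θ) with hf
  have hscale : ∀ᶠ t : ℕ in atTop,
      ∫ x in Set.Ioi (0 : ℝ), (Set.Ioc 0 (Real.pi * √t)).indicator (fun x => f t (x / √t)) x =
        √t * ∫ θ in (0 : ℝ)..Real.pi, f t θ := by
    filter_upwards [eventually_gt_atTop 0] with t ht
    have hs : 0 < √(t : ℝ) := Real.sqrt_pos.mpr (by exact_mod_cast ht)
    rw [MeasureTheory.setIntegral_indicator measurableSet_Ioc,
      Set.inter_eq_right.mpr Set.Ioc_subset_Ioi_self,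
      ← intervalIntegral.integral_of_le (by positivity),
      intervalIntegral.integral_comp_div _ hs.ne', zero_div, mul_div_cancel_right₀ _ hs.ne',
      smul_eq_mul]
  refine Tendsto.congr' hscale ?_
  rw [← integral_gaussian_Ioi]
  refine MeasureTheory.tendsto_integral_of_dominated_convergence
    (fun x => Real.exp (-k * x ^ 2)) (fun t => ?_)
    (integrable_exp_neg_mul_sq hk0).integrableOn (fun t => ?_) ?_
  · refine (Continuous.aestronglyMeasurable ?_).indicator measurableSet_Ioc
    fun_prop
  · refine Eventually.of_forall fun x => ?_
    by_cases hx : x ∈ Set.Ioc 0 (Real.pi * √t)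
    · rw [Set.indicator_of_mem hx]
      have hs : 0 < √(t : ℝ) :=
        pos_of_mul_pos_right (hx.1.trans_le hx.2) Real.pi_pos.le
      have ht : (0 : ℝ) < t := Real.sqrt_pos.mp hs
      have hxs : |x / √t| ≤ Real.pi := by
        rw [abs_of_pos (div_pos hx.1 hs), div_le_iff₀ hs]
        exact hx.2
      have hle := abs_one_sub_mul_one_sub_cos_le hp0 hp1 hxs
      rw [hf, Real.norm_eq_abs, abs_mul, abs_pow]
      calc _ ≤ Real.exp (-k * (x / √t) ^ 2) ^ t * 1 := by
            gcongr
            exact Real.abs_cos_le_one _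
        _ = Real.exp (-k * x ^ 2) := by
            rw [mul_one, ← Real.exp_nat_mul, div_pow, Real.sq_sqrt ht.le]
            congr 1
            field_simp
    · rw [Set.indicator_of_notMem hx, norm_zero]
      exact (Real.exp_pos _).le
  · refine (MeasureTheory.ae_restrict_iff' measurableSet_Ioi).mpr
      (Eventually.of_forall fun x hx => ?_)
    have hsqrt : Tendsto (fun t : ℕ => √(t : ℝ)) atTop atTop :=
      Real.tendsto_sqrt_atTop.comp tendsto_natCast_atTop_atTop
    have hmem : ∀ᶠ t : ℕ in atTop,
        f t (x / √t) = (Set.Ioc 0 (Real.pi * √t)).indicator (fun x => f t (x / √t)) x := by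
      filter_upwards [(hsqrt.const_mul_atTop Real.pi_pos).eventually_ge_atTop x] with t ht
      have hxt : x ∈ Set.Ioc 0 (Real.pi * √(t : ℝ)) := ⟨hx, ht⟩
      rw [Set.indicator_of_mem hxt]
    refine Tendsto.congr' hmem ?_
    have hpow : Tendsto (fun t : ℕ => (1 + -(p * (1 - Real.cos (x / √t)))) ^ t) atTop
        (nhds (Real.exp (-(p / 2) * x ^ 2))) := by
      refine Real.tendsto_one_add_pow_exp_of_tendsto ?_
      have := (tendsto_natCast_mul_one_sub_cos_div_sqrt x).const_mul (-p)
      convert this using 2 <;> ring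
    have hcos : Tendsto (fun t : ℕ => Real.cos (n * (x / √t))) atTop (nhds 1) := by
      have h0 : Tendsto (fun t : ℕ => (n : ℝ) * (x / √t)) atTop (nhds 0) := by
        simpa using (hsqrt.const_div_atTop x).const_mul (n : ℝ)
      simpa [Function.comp_def] using (Real.continuous_cos.tendsto 0).comp h0
    simpa [hf, sub_eq_add_neg] using hpow.mul hcos

theorem uSol_eq_integral {d : ℝ} (hd : d ≠ 1 / 2) (n : ℤ) (t : ℕ) :
    uSol d n t = Real.pi⁻¹ * ∫ θ in (0 : ℝ)..Real.pi,
      (1 - 2 * d + 2 * d * Real.cos θ) ^ t * Real.cos (n.natAbs * θ) := by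
  have ha : 1 - 2 * d ≠ 0 := fun h => hd (by linarith)
  rw [← pi_mul_pow_mul_besselI _ _ ha, inv_mul_cancel_left₀ Real.pi_ne_zero, uSol]

theorem neg_one_zpow_add_natCast (n : ℤ) (t : ℕ) :
    (-1 : ℝ) ^ (n + (t : ℤ)) = (-1) ^ (n.natAbs + t) := by
  rw [zpow_add₀ (by norm_num), zpow_natCast, pow_add]
  congr 1
  rcases Int.natAbs_eq n with h | h
  · conv_lhs => rw [h, zpow_natCast]
  · conv_lhs => rw [h, zpow_neg, zpow_natCast, ← inv_pow, inv_neg_one]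

theorem integral_pow_mul_cos_reflect {d : ℝ} (hd : 4 * d - 1 ≠ 0) (n t : ℕ) :
    ∫ θ in (0 : ℝ)..Real.pi, (1 - 2 * d + 2 * d * Real.cos θ) ^ t * Real.cos (n * θ) =
      (-1) ^ (n + t) * (4 * d - 1) ^ t *
        ∫ θ in (0 : ℝ)..Real.pi,
          (1 - 2 * d / (4 * d - 1) * (1 - Real.cos θ)) ^ t * Real.cos (n * θ) := by
  have h := intervalIntegral.integral_comp_sub_left (a := 0) (b := Real.pi)
    (fun θ => (1 - 2 * d + 2 * d * Real.cos θ) ^ t * Real.cos (n * θ)) Real.pi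
  rw [sub_self, sub_zero] at h
  rw [← h, ← intervalIntegral.integral_const_mul]
  refine intervalIntegral.integral_congr fun θ _ => ?_
  have e1 : 1 - 2 * d + 2 * d * Real.cos (Real.pi - θ) =
      -1 * (4 * d - 1) * (1 - 2 * d / (4 * d - 1) * (1 - Real.cos θ)) := by
    rw [Real.cos_pi_sub]
    linear_combination -(1 - Real.cos θ) * mul_div_cancel₀ (2 * d) hd
  have e2 : Real.cos (n * (Real.pi - θ)) = (-1) ^ n * Real.cos (n * θ) := by
    rw [mul_sub, Real.cos_nat_mul_pi_sub]
  simp only [e1, e2, mul_pow, pow_add]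
  ring

theorem stmt12 (d : ℝ) (hd : 0 < d) (hd' : d ≠ 1 / 2) (n : ℤ) :
    (d < 1 / 2 →
      Tendsto (fun t : ℕ => uSol d n t * (2 * Real.sqrt (Real.pi * d * t)))
        atTop (nhds 1)) ∧
    (1 / 2 < d →
      Tendsto (fun t : ℕ =>
        uSol d n t * (2 * Real.sqrt (Real.pi * d * t)) /
          ((-1 : ℝ) ^ (n + (t : ℤ)) * (4 * d - 1) ^ ((t : ℝ) + 1 / 2)))
        atTop (nhds 1)) := by
  have hπ := Real.pi_pos
  constructor
  · intro hlt
    have h := (tendsto_sqrt_mul_integral_one_sub_pow_mul_cos (p := 2 * d) (by linarith)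
      (by linarith) n.natAbs).const_mul (Real.pi⁻¹ * (2 * √(Real.pi * d)))
    have hlim : Real.pi⁻¹ * (2 * √(Real.pi * d)) * (√(Real.pi / (2 * d / 2)) / 2) = 1 := by
      have : √(Real.pi * d) * √(Real.pi / (2 * d / 2)) = Real.pi := by
        rw [← Real.sqrt_mul (by positivity), Real.sqrt_eq_iff_mul_self_eq_of_pos hπ]
        field_simp
      calc _ = Real.pi⁻¹ * (√(Real.pi * d) * √(Real.pi / (2 * d / 2))) := by ring
        _ = 1 := by rw [this, inv_mul_cancel₀ hπ.ne']
    rw [hlim] at h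
    refine h.congr fun t => ?_
    rw [uSol_eq_integral hd', Real.sqrt_mul (by positivity) (t : ℝ)]
    simp_rw [show ∀ θ, 1 - 2 * d + 2 * d * Real.cos θ = 1 - 2 * d * (1 - Real.cos θ) by
      intro θ; ring]
    ring
  · intro hlt
    have hr : 0 < 4 * d - 1 := by linarith
    have h := (tendsto_sqrt_mul_integral_one_sub_pow_mul_cos (p := 2 * d / (4 * d - 1))
      (by positivity) ((div_lt_one hr).mpr (by linarith)) n.natAbs).const_mul
        (Real.pi⁻¹ * (2 * √(Real.pi * d)) / √(4 * d - 1))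
    have hlim : Real.pi⁻¹ * (2 * √(Real.pi * d)) / √(4 * d - 1) *
        (√(Real.pi / (2 * d / (4 * d - 1) / 2)) / 2) = 1 := by
      have : √(Real.pi * d) * √(Real.pi / (2 * d / (4 * d - 1) / 2)) =
          Real.pi * √(4 * d - 1) := by
        rw [← Real.sqrt_mul (by positivity), ← Real.sqrt_sq hπ.le,
          ← Real.sqrt_mul (by positivity), Real.sqrt_sq hπ.le]
        congr 1
        field_simp
      have hs : 0 < √(4 * d - 1) := Real.sqrt_pos.mpr hr
      calc _ = Real.pi⁻¹ / √(4 * d - 1) *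
            (√(Real.pi * d) * √(Real.pi / (2 * d / (4 * d - 1) / 2))) := by ring
        _ = 1 := by rw [this]; field_simp
    rw [hlim] at h
    refine h.congr fun t => ?_
    rw [uSol_eq_integral hd', Real.sqrt_mul (by positivity) (t : ℝ),
      integral_pow_mul_cos_reflect hr.ne', neg_one_zpow_add_natCast, Real.rpow_add hr,
      Real.rpow_natCast, ← Real.sqrt_eq_rpow]
    have hs : √(4 * d - 1) ≠ 0 := (Real.sqrt_pos.mpr hr).ne'
    have hm : (-1 : ℝ) ^ (n.natAbs + t) ≠ 0 := pow_ne_zero _ (by norm_num)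
    generalize (∫ θ in (0 : ℝ)..Real.pi,
      (1 - 2 * d / (4 * d - 1) * (1 - Real.cos θ)) ^ t * Real.cos (n.natAbs * θ)) = J
    generalize 4 * d - 1 = r at hr hs ⊢
    field_simp
end

section
/- Let q ≥ 1 be an integer and let X be a connected (q+1)-regular simple graph with fixed base vertex x0. Then for every vertex x and every integer t ≥ 0: K_X(x0,x;t) = (−q)^t · Σ_{k=0}^{t} (−1)^k · C(t,k) · (1 + 1/q)^k · K_X^rw(x0,x;k), and K_X^rw(x0,x;t) = (q+1)^{−t} · Σ_{k=0}^{t} C(t,k) · q^{t−k} · K_X(x0,x;k), where C(t,k) is the binomial coefficient. -/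
open Finset

/-- The adjacency operator of a locally finite graph, acting on real functions on the vertices. -/
noncomputable def adjacencyOperator {V : Type*} (G : SimpleGraph V) [G.LocallyFinite] :
    Module.End ℝ (V → ℝ) where
  toFun f x := ∑ y ∈ G.neighborFinset x, f y
  map_add' f g := by
    ext x
    simp [Finset.sum_add_distrib]
  map_smul' c f := by
    ext x
    simp [Finset.mul_sum]

theorem Module.End.add_smul_one_pow_apply {R M : Type*} [CommRing R] [AddCommGroup M] [Module R M]
    (A : Module.End R M) (c : R) (t : ℕ) (v : M) :
    ((A + c • 1) ^ t) v =
      ∑ k ∈ Finset.range (t + 1), ((t.choose k : R) * c ^ (t - k)) • (A ^ k) v := by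
  have h : Commute A (c • 1) := (Commute.one_right A).smul_right c
  rw [h.add_pow, LinearMap.sum_apply]
  refine Finset.sum_congr rfl fun k _ => ?_
  rw [smul_pow, one_pow, mul_smul_comm, mul_one, ← nsmul_eq_mul', LinearMap.smul_apply,
    LinearMap.smul_apply, mul_smul, Nat.cast_smul_eq_nsmul]

theorem stmt16 {V : Type*} [DecidableEq V] (q : ℕ) (hq : 1 ≤ q) (G : SimpleGraph V)
    [G.LocallyFinite] (hconn : G.Connected) (hreg : G.IsRegularOfDegree (q + 1)) (x0 : V)
    (K Krw : V → ℕ → ℝ)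
    (hK0 : ∀ x, K x 0 = if x = x0 then 1 else 0)
    (hKrec : ∀ x t, K x (t + 1) = (∑ y ∈ G.neighborFinset x, K y t) - (q : ℝ) * K x t)
    (hKrw0 : ∀ x, Krw x 0 = if x = x0 then 1 else 0)
    (hKrwrec : ∀ x t, Krw x (t + 1) = (1 / ((q : ℝ) + 1)) * ∑ y ∈ G.neighborFinset x, Krw y t)
    (x : V) (t : ℕ) :
    K x t = (-(q : ℝ)) ^ t * ∑ k ∈ Finset.range (t + 1),
        (-1 : ℝ) ^ k * (t.choose k : ℝ) * (1 + 1 / (q : ℝ)) ^ k * Krw x k ∧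
    Krw x t = (((q : ℝ) + 1) ^ t)⁻¹ * ∑ k ∈ Finset.range (t + 1),
        (t.choose k : ℝ) * (q : ℝ) ^ (t - k) * K x k := by
  have hq0 : (q : ℝ) ≠ 0 := by positivity
  have hq1 : (q : ℝ) + 1 ≠ 0 := by positivity
  set A := adjacencyOperator G
  have hAapp : ∀ f x, A f x = ∑ y ∈ G.neighborFinset x, f y := fun _ _ => rfl
  set δ : V → ℝ := fun x => if x = x0 then 1 else 0 with hδ
  set B : Module.End ℝ (V → ℝ) := A + (-(q : ℝ)) • 1 with hB
  have hK : ∀ t, (fun x => K x t) = (B ^ t) δ := by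
    intro t
    induction t with
    | zero => ext x; simp [hK0, hδ]
    | succ t ih =>
      rw [pow_succ', Module.End.mul_apply, ← ih]
      ext x
      simp [hB, hAapp, hKrec, sub_eq_add_neg]
  have hKrw : ∀ t, (fun x => Krw x t) = (((q : ℝ) + 1) ^ t)⁻¹ • (A ^ t) δ := by
    intro t
    induction t with
    | zero => ext x; simp [hKrw0, hδ]
    | succ t ih =>
      have h : (fun x => Krw x (t + 1)) = ((q : ℝ) + 1)⁻¹ • A (fun x => Krw x t) := by
        ext x
        simp [hAapp, hKrwrec]
      rw [h, ih, map_smul, smul_smul, pow_succ' A, Module.End.mul_apply, pow_succ', mul_inv]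
  constructor
  · rw [congrFun (hK t) x, hB, Module.End.add_smul_one_pow_apply, Finset.sum_apply,
      Finset.mul_sum]
    refine Finset.sum_congr rfl fun k hk => ?_
    have hkt : k ≤ t := Finset.mem_range_succ_iff.mp hk
    have hc : (-(q : ℝ)) ^ t * ((-1) ^ k * (1 + 1 / (q : ℝ)) ^ k * (((q : ℝ) + 1) ^ k)⁻¹) =
        (-(q : ℝ)) ^ (t - k) := by
      have h1 : (-1 : ℝ) * (1 + 1 / (q : ℝ)) * ((q : ℝ) + 1)⁻¹ = (-(q : ℝ))⁻¹ := by
        field_simp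
      rw [← inv_pow, ← mul_pow, ← mul_pow, h1, inv_pow, pow_sub₀ _ (neg_ne_zero.mpr hq0) hkt]
    rw [congrFun (hKrw k) x, Pi.smul_apply, Pi.smul_apply, smul_eq_mul, smul_eq_mul, ← hc]
    ring
  · have hAB : A = B + (q : ℝ) • 1 := by
      ext f x
      simp [hB]
    rw [congrFun (hKrw t) x, hAB, Module.End.add_smul_one_pow_apply, Pi.smul_apply,
      Finset.sum_apply, smul_eq_mul]
    congr 1
    refine Finset.sum_congr rfl fun k _ => ?_
    rw [Pi.smul_apply, smul_eq_mul, ← congrFun (hK k) x]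
end
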